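/- arXiv:2308.12159 — 7 statements merged into one kernel-verified Lean document; each statement's English description precedes it below -/
import Mathlib

section
/- Let f(x,y) = sqrt((x + y − 2)/(x·y)) for real numbers x, y ≥ 1, and for an integer a ≥ 2 let g_a(x) = f(x,a) − f(x,a−1). Then: (i) for every integer a ≥ 2 and every real x ≥ 2, g_a(x) ≤ g_a(2) ≤ g_a(1); (ii) the sequence a ↦ g_a(1) is strictly decreasing in the integer a ≥ 2; (iii) for every fixed real x ≥ 3, the sequence a ↦ g_a(x) is strictly increasing in the integer a ≥ 2. -/
/-- `f x y = sqrt ((x + y - 2) / (x * y))`. -/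
noncomputable def f (x y : ℝ) : ℝ := Real.sqrt ((x + y - 2) / (x * y))

/-- `g a x = f x a - f x (a - 1)` for an integer `a`. -/
noncomputable def g (a : ℕ) (x : ℝ) : ℝ := f x (a : ℝ) - f x ((a : ℝ) - 1)

theorem f_nonneg (x y : ℝ) : 0 ≤ f x y := Real.sqrt_nonneg _

theorem f_sq {x y : ℝ} (hx : 1 ≤ x) (hy : 1 ≤ y) : f x y ^ 2 = (x + y - 2) / (x * y) :=
  Real.sq_sqrt (div_nonneg (by linarith) (by positivity))

theorem f_two_left {y : ℝ} (hy : y ≠ 0) : f 2 y = √(1 / 2) := by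
  unfold f
  congr 1
  field_simp
  ring

theorem f_antitone_right {x y z : ℝ} (hx : 2 ≤ x) (hy : 1 ≤ y) (hyz : y ≤ z) :
    f x z ≤ f x y := by
  refine Real.sqrt_le_sqrt ?_
  rw [div_le_div_iff₀ (by nlinarith) (by nlinarith)]
  have h : 0 ≤ x * ((x - 2) * (z - y)) :=
    mul_nonneg (by linarith) (mul_nonneg (by linarith) (by linarith))
  linarith

theorem f_one_left_monotone {y z : ℝ} (hy : 1 ≤ y) (hyz : y ≤ z) : f 1 y ≤ f 1 z := by
  refine Real.sqrt_le_sqrt ?_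
  rw [div_le_div_iff₀ (by linarith) (by linarith)]
  linarith

theorem f_one_left_midpoint_lt {y : ℝ} (hy : 2 ≤ y) :
    f 1 (y - 1) + f 1 (y + 1) < 2 * f 1 y := by
  have h₁ := f_sq le_rfl (show 1 ≤ y - 1 by linarith)
  have h₂ := f_sq le_rfl (show 1 ≤ y by linarith)
  have h₃ := f_sq le_rfl (show 1 ≤ y + 1 by linarith)
  have key : (1 + (y - 1) - 2) / (1 * (y - 1)) + (1 + (y + 1) - 2) / (1 * (y + 1)) <
      2 * ((1 + y - 2) / (1 * y)) := by
    rw [div_add_div _ _ (by linarith) (by linarith), ← mul_div_assoc,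
      div_lt_div_iff₀ (by nlinarith) (by linarith)]
    nlinarith
  refine lt_of_pow_lt_pow_left₀ 2 (mul_nonneg zero_le_two (f_nonneg _ _)) ?_
  nlinarith [sq_nonneg (f 1 (y - 1) - f 1 (y + 1))]

theorem two_mul_f_lt_add {x y : ℝ} (hx : 2 < x) (hy : 2 ≤ y) :
    2 * f x y < f x (y - 1) + f x (y + 1) := by
  have hx₁ : 1 ≤ x := by linarith
  have h₁ := f_sq hx₁ (show 1 ≤ y - 1 by linarith)
  have h₂ := f_sq hx₁ (show 1 ≤ y by linarith)
  have h₃ := f_sq hx₁ (show 1 ≤ y + 1 by linarith)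
  have n₁ := f_nonneg x (y - 1)
  have n₃ := f_nonneg x (y + 1)
  have key : ((x + y - 2) / (x * y)) ^ 2 <
      (x + (y - 1) - 2) / (x * (y - 1)) * ((x + (y + 1) - 2) / (x * (y + 1))) := by
    rw [div_pow, div_mul_div_comm, div_lt_div_iff₀ (by positivity)
      (mul_pos (mul_pos (by linarith) (by linarith)) (mul_pos (by linarith) (by linarith)))]
    have h : 0 < x ^ 2 * ((x - 2) * (x + 2 * y - 2)) :=
      mul_pos (by positivity) (mul_pos (by linarith) (by linarith))
    linarith
  have hlog : f x y ^ 2 < f x (y - 1) * f x (y + 1) := by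
    refine lt_of_pow_lt_pow_left₀ 2 (mul_nonneg n₁ n₃) ?_
    rw [mul_pow, h₁, h₂, h₃]
    exact key
  refine lt_of_pow_lt_pow_left₀ 2 (add_nonneg n₁ n₃) ?_
  nlinarith [sq_nonneg (f x (y - 1) - f x (y + 1))]

theorem g_succ (a : ℕ) (x : ℝ) : g (a + 1) x = f x ((a : ℝ) + 1) - f x a := by
  simp [g]

theorem stmt1 :
    (∀ a : ℕ, 2 ≤ a → ∀ x : ℝ, 2 ≤ x → g a x ≤ g a 2 ∧ g a 2 ≤ g a 1) ∧
    (∀ a b : ℕ, 2 ≤ a → a < b → g b 1 < g a 1) ∧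
    (∀ x : ℝ, 3 ≤ x → ∀ a b : ℕ, 2 ≤ a → a < b → g a x < g b x) := by
  refine ⟨fun a ha x hx => ?_, fun a b ha hab => ?_, fun x hx a b ha hab => ?_⟩
  · have ha' : (2 : ℝ) ≤ a := by exact_mod_cast ha
    have hg : g a 2 = 0 := by
      rw [g, f_two_left (by linarith), f_two_left (by linarith), sub_self]
    rw [hg]
    exact ⟨sub_nonpos.2 (f_antitone_right hx (by linarith) (by linarith)),
      sub_nonneg.2 (f_one_left_monotone (by linarith) (by linarith))⟩
  · have step (n : ℕ) (hn : 2 ≤ n) : g (n + 1) 1 < g n 1 := by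
      have := f_one_left_midpoint_lt (y := n) (by exact_mod_cast hn)
      rw [g_succ, g]
      linarith
    induction b, hab using Nat.le_induction with
    | base => exact step a ha
    | succ n hn ih => exact (step n (by lia)).trans ih
  · have step (n : ℕ) (hn : 2 ≤ n) : g n x < g (n + 1) x := by
      have := two_mul_f_lt_add (x := x) (y := n) (by linarith) (by exact_mod_cast hn)
      rw [g_succ, g]
      linarith
    induction b, hab using Nat.le_induction with
    | base => exact step a ha
    | succ n hn ih => exact ih.trans (step n (by lia))
end

section
/- For every integer n with 10 ≤ n ≤ 15 and every integer x with 1 ≤ x ≤ n − 6, one has sqrt(x/(x+1)) + sqrt((n−3−x)/(n−2−x)) + sqrt((n−3)/((x+1)(n−2−x))) ≤ sqrt(2/3) + sqrt((n−5)/(n−4)) + sqrt((n−3)/(3(n−4))), with equality if and only if x = 2. -/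
/-- `F n x = sqrt (x/(x+1)) + sqrt ((n-3-x)/(n-2-x)) + sqrt ((n-3)/((x+1)(n-2-x)))`. -/
noncomputable def F (n x : ℕ) : ℝ :=
  Real.sqrt ((x : ℝ) / ((x : ℝ) + 1)) +
    Real.sqrt (((n : ℝ) - 3 - (x : ℝ)) / ((n : ℝ) - 2 - (x : ℝ))) +
    Real.sqrt (((n : ℝ) - 3) / (((x : ℝ) + 1) * ((n : ℝ) - 2 - (x : ℝ))))

/-- The integer part of `10 ^ 4 * √(p / q)`. -/
def scaledSqrt (p q : ℕ) : ℕ := Nat.sqrt (10 ^ 8 * p / q)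

lemma scaledSqrt_le (p q : ℕ) (hq : 0 < q) :
    (scaledSqrt p q : ℝ) ≤ 10 ^ 4 * √((p : ℝ) / q) := by
  have hq' : (0 : ℝ) < q := by exact_mod_cast hq
  have h : scaledSqrt p q ^ 2 * q ≤ 10 ^ 8 * p :=
    (Nat.le_div_iff_mul_le hq).mp (Nat.sqrt_le' _)
  have h' : (scaledSqrt p q : ℝ) ^ 2 * q ≤ 10 ^ 8 * p := by exact_mod_cast h
  have key : (scaledSqrt p q : ℝ) / 10 ^ 4 ≤ √((p : ℝ) / q) := by
    apply Real.le_sqrt_of_sq_le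
    rw [le_div_iff₀ hq']
    linarith
  linarith

lemma lt_scaledSqrt_add_one (p q : ℕ) (hq : 0 < q) :
    10 ^ 4 * √((p : ℝ) / q) < scaledSqrt p q + 1 := by
  have hq' : (0 : ℝ) < q := by exact_mod_cast hq
  have h : 10 ^ 8 * p < (scaledSqrt p q + 1) ^ 2 * q :=
    (Nat.div_lt_iff_lt_mul hq).mp (Nat.lt_succ_sqrt' _)
  have h' : (10 : ℝ) ^ 8 * p < ((scaledSqrt p q : ℝ) + 1) ^ 2 * q := by exact_mod_cast h
  have key : √((p : ℝ) / q) < ((scaledSqrt p q : ℝ) + 1) / 10 ^ 4 := by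
    rw [Real.sqrt_lt' (by positivity), div_lt_iff₀ hq']
    linarith
  linarith

/-- The integer approximation of `10 ^ 4 * F n x` obtained by rounding each root down. -/
def scaledF (n x : ℕ) : ℕ :=
  scaledSqrt x (x + 1) + scaledSqrt (n - 3 - x) (n - 2 - x) +
    scaledSqrt (n - 3) ((x + 1) * (n - 2 - x))

lemma scaledF_bounds (n x : ℕ) (h : x + 3 ≤ n) :
    (scaledF n x : ℝ) ≤ 10 ^ 4 * F n x ∧ 10 ^ 4 * F n x < scaledF n x + 3 := by
  have hF : F n x = √((x : ℝ) / (x + 1 : ℕ)) + √(((n - 3 - x : ℕ) : ℝ) / (n - 2 - x : ℕ)) +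
      √(((n - 3 : ℕ) : ℝ) / ((x + 1) * (n - 2 - x) : ℕ)) := by
    rw [F]
    push_cast [Nat.cast_sub (show 3 ≤ n by omega), Nat.cast_sub (show 2 ≤ n by omega),
      Nat.cast_sub (show x ≤ n - 3 by omega), Nat.cast_sub (show x ≤ n - 2 by omega)]
    rfl
  have hq : 0 < n - 2 - x := by omega
  have l₁ := scaledSqrt_le x (x + 1) (by omega)
  have l₂ := scaledSqrt_le (n - 3 - x) (n - 2 - x) hq
  have l₃ := scaledSqrt_le (n - 3) ((x + 1) * (n - 2 - x)) (by positivity)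
  have u₁ := lt_scaledSqrt_add_one x (x + 1) (by omega)
  have u₂ := lt_scaledSqrt_add_one (n - 3 - x) (n - 2 - x) hq
  have u₃ := lt_scaledSqrt_add_one (n - 3) ((x + 1) * (n - 2 - x)) (by positivity)
  rw [hF, scaledF]
  simp only [Nat.cast_add (scaledSqrt _ _ + scaledSqrt _ _), Nat.cast_add (scaledSqrt _ _)]
  constructor <;> linarith

lemma scaledF_add_three_le (n x : ℕ) (hn1 : 10 ≤ n) (hn2 : n ≤ 15) (hx1 : 1 ≤ x)
    (hx2 : x ≤ n - 6) (hx : x ≠ 2) : scaledF n x + 3 ≤ scaledF n 2 := by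
  have hx' : x ≤ 9 := by omega
  interval_cases n <;> interval_cases x <;> first | omega | norm_num [scaledF, scaledSqrt]

lemma F_lt_F_two (n x : ℕ) (hn1 : 10 ≤ n) (hn2 : n ≤ 15) (hx1 : 1 ≤ x)
    (hx2 : x ≤ n - 6) (hx : x ≠ 2) : F n x < F n 2 := by
  have h : (scaledF n x : ℝ) + 3 ≤ scaledF n 2 := by
    exact_mod_cast scaledF_add_three_le n x hn1 hn2 hx1 hx2 hx
  have hu := (scaledF_bounds n x (by omega)).2
  have hl := (scaledF_bounds n 2 (by omega)).1
  linarith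

lemma F_two (n : ℕ) : F n 2 = Real.sqrt (2 / 3) + Real.sqrt (((n : ℝ) - 5) / ((n : ℝ) - 4)) +
    Real.sqrt (((n : ℝ) - 3) / (3 * ((n : ℝ) - 4))) := by
  have h₁ : (n : ℝ) - 3 - 2 = n - 5 := by ring
  have h₂ : (n : ℝ) - 2 - 2 = n - 4 := by ring
  have h₃ : (2 : ℝ) + 1 = 3 := by norm_num
  rw [F, Nat.cast_ofNat, h₁, h₂, h₃]

theorem stmt5 (n x : ℕ) (hn1 : 10 ≤ n) (hn2 : n ≤ 15) (hx1 : 1 ≤ x) (hx2 : x ≤ n - 6) :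
    F n x ≤ Real.sqrt (2 / 3) + Real.sqrt (((n : ℝ) - 5) / ((n : ℝ) - 4)) +
        Real.sqrt (((n : ℝ) - 3) / (3 * ((n : ℝ) - 4))) ∧
    (F n x = Real.sqrt (2 / 3) + Real.sqrt (((n : ℝ) - 5) / ((n : ℝ) - 4)) +
        Real.sqrt (((n : ℝ) - 3) / (3 * ((n : ℝ) - 4))) ↔ x = 2) := by
  rw [← F_two]
  by_cases hx : x = 2
  · subst hx
    exact ⟨le_rfl, iff_of_true rfl rfl⟩
  · have h := F_lt_F_two n x hn1 hn2 hx1 hx2 hx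
    exact ⟨h.le, iff_of_false h.ne hx⟩
end

section
/- For every integer n ≥ 16 and every integer x with 1 ≤ x ≤ n − 6, one has sqrt(x/(x+1)) + sqrt((n−3−x)/(n−2−x)) + sqrt((n−3)/((x+1)(n−2−x))) ≤ sqrt(2) + sqrt((n−4)/(n−3)), with equality if and only if x = 1. -/
open Real in
/-- Tangent line bound for the square root at `c ^ 2`. -/
lemma sqrt_le_tangent {t c : ℝ} (ht : 0 ≤ t) (hc : 0 < c) : √t ≤ (t + c ^ 2) / (2 * c) := by
  rw [le_div_iff₀ (by positivity)]
  nlinarith [sq_nonneg (√t - c), sq_sqrt ht]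

open Real in
lemma sqrt_add_sqrt_add_sqrt_le {u v : ℝ} (hu : 0 ≤ u) (hu' : u ≤ 1 / 8) (hv : 0 ≤ v)
    (hv' : v ≤ 1 / 4) : √(1 - u) + √(1 - v) + √(u + v - 2 * u * v) ≤ 237 / 100 := by
  have h1 := sqrt_le_tangent (t := 1 - u) (c := 1) (by linarith) (by norm_num)
  have h2 := sqrt_le_tangent (t := 1 - v) (c := 13 / 15) (by linarith) (by norm_num)
  have h3 := sqrt_le_tangent (t := u + v - 2 * u * v) (c := 1 / 2) (by nlinarith) (by norm_num)
  have h4 := mul_nonneg hu (sub_nonneg.2 hv')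
  norm_num at h1 h2 h3
  nlinarith

lemma sqrt_two_gt : (141421 / 100000 : ℝ) < √2 := Real.lt_sqrt_of_sq_lt (by norm_num)

lemma F_one {n : ℕ} (hn : 4 ≤ n) : F n 1 = √2 + √(((n : ℝ) - 4) / ((n : ℝ) - 3)) := by
  have hn' : (4 : ℝ) ≤ n := by exact_mod_cast hn
  have h : ((n : ℝ) - 3) / ((1 + 1) * ((n : ℝ) - 2 - 1)) = 1 / 2 := by
    have : (n : ℝ) - 3 ≠ 0 := by linarith
    rw [show (n : ℝ) - 2 - 1 = n - 3 by ring]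
    field_simp
    norm_num
  have h2 : √(1 / 2 : ℝ) = √2 / 2 := by
    rw [Real.sqrt_eq_iff_mul_self_eq (by norm_num) (by positivity)]
    nlinarith [Real.sq_sqrt (show (0 : ℝ) ≤ 2 by norm_num)]
  unfold F
  rw [Nat.cast_one, h, show (1 : ℝ) / (1 + 1) = 1 / 2 by norm_num, h2,
    show (n : ℝ) - 3 - 1 = n - 4 by ring, show (n : ℝ) - 2 - 1 = n - 3 by ring]
  ring

lemma F_two_lt {n : ℕ} (hn : 16 ≤ n) : F n 2 < √2 + √(((n : ℝ) - 4) / ((n : ℝ) - 3)) := by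
  have hs := sqrt_two_gt
  have h1 : √(2 / 3 : ℝ) < 816497 / 1000000 := by
    rw [Real.sqrt_lt' (by norm_num)]; norm_num
  unfold F
  rw [Nat.cast_ofNat, show (2 : ℝ) / (2 + 1) = 2 / 3 by norm_num]
  obtain rfl | rfl | hn' : n = 16 ∨ n = 17 ∨ 18 ≤ n := by omega
  · have h2 : √(11 / 12 : ℝ) < 957428 / 1000000 := by
      rw [Real.sqrt_lt' (by norm_num)]; norm_num
    have h3 : √(13 / 36 : ℝ) < 600926 / 1000000 := by
      rw [Real.sqrt_lt' (by norm_num)]; norm_num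
    have h4 : (960768 / 1000000 : ℝ) < √(12 / 13) := Real.lt_sqrt_of_sq_lt (by norm_num)
    norm_num at *
    linarith
  · have h2 : √(12 / 13 : ℝ) < 960770 / 1000000 := by
      rw [Real.sqrt_lt' (by norm_num)]; norm_num
    have h3 : √(14 / 39 : ℝ) < 599146 / 1000000 := by
      rw [Real.sqrt_lt' (by norm_num)]; norm_num
    have h4 : (963624 / 1000000 : ℝ) < √(13 / 14) := Real.lt_sqrt_of_sq_lt (by norm_num)
    norm_num at *
    linarith
  · have hn'' : (18 : ℝ) ≤ n := by exact_mod_cast hn'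
    have h2 : √(((n : ℝ) - 3 - 2) / (n - 2 - 2)) ≤ √(((n : ℝ) - 4) / (n - 3)) := by
      apply Real.sqrt_le_sqrt
      rw [div_le_div_iff₀ (by linarith) (by linarith)]
      nlinarith
    have h3 : √(((n : ℝ) - 3) / ((2 + 1) * (n - 2 - 2))) < 59762 / 100000 := by
      rw [Real.sqrt_lt' (by norm_num), div_lt_iff₀ (by linarith)]
      linarith
    linarith

lemma F_lt_of_three_le {n x : ℕ} (hn : 16 ≤ n) (hx : 3 ≤ x) (hxn : x + 6 ≤ n) :
    F n x < √2 + √(((n : ℝ) - 4) / ((n : ℝ) - 3)) := by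
  have hn' : (16 : ℝ) ≤ n := by exact_mod_cast hn
  have hx' : (3 : ℝ) ≤ x := by exact_mod_cast hx
  have hxn' : (x : ℝ) + 6 ≤ n := by exact_mod_cast hxn
  have hs := sqrt_two_gt
  have h4 : (9607 / 10000 : ℝ) < √(((n : ℝ) - 4) / (n - 3)) := by
    apply Real.lt_sqrt_of_sq_lt
    rw [lt_div_iff₀ (by linarith)]
    linarith
  suffices F n x ≤ 237 / 100 by linarith
  have ha : (0 : ℝ) < x + 1 := by linarith
  have hb : (0 : ℝ) < n - 2 - x := by linarith
  have e1 : (x : ℝ) / (x + 1) = 1 - 1 / (x + 1) := by field_simp; ring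
  have e2 : ((n : ℝ) - 3 - x) / (n - 2 - x) = 1 - 1 / (n - 2 - x) := by field_simp; ring
  have e3 : ((n : ℝ) - 3) / ((x + 1) * (n - 2 - x)) =
      1 / (x + 1) + 1 / (n - 2 - x) - 2 * (1 / (x + 1)) * (1 / (n - 2 - x)) := by
    field_simp; ring
  unfold F
  rw [e1, e2, e3]
  have hu : 1 / ((x : ℝ) + 1) ≤ 1 / 4 := one_div_le_one_div_of_le (by norm_num) (by linarith)
  have hv : 1 / ((n : ℝ) - 2 - x) ≤ 1 / 4 := one_div_le_one_div_of_le (by norm_num) (by linarith)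
  obtain h | h : 7 ≤ x ∨ x + 10 ≤ n := by omega
  · have h' : (7 : ℝ) ≤ x := by exact_mod_cast h
    exact sqrt_add_sqrt_add_sqrt_le (by positivity)
      (one_div_le_one_div_of_le (by norm_num) (by linarith)) (by positivity) hv
  · have h' : (x : ℝ) + 10 ≤ n := by exact_mod_cast h
    have := sqrt_add_sqrt_add_sqrt_le (u := 1 / ((n : ℝ) - 2 - x)) (by positivity)
      (one_div_le_one_div_of_le (by norm_num) (by linarith)) (by positivity) hu
    convert this using 1
    ring_nf

theorem stmt6 (n x : ℕ) (hn : 16 ≤ n) (hx1 : 1 ≤ x) (hx2 : x ≤ n - 6) :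
    F n x ≤ Real.sqrt 2 + Real.sqrt (((n : ℝ) - 4) / ((n : ℝ) - 3)) ∧
    (F n x = Real.sqrt 2 + Real.sqrt (((n : ℝ) - 4) / ((n : ℝ) - 3)) ↔ x = 1) := by
  obtain rfl | hx : x = 1 ∨ 2 ≤ x := by omega
  · have h := F_one (n := n) (by omega)
    exact ⟨h.le, iff_of_true h rfl⟩
  · have h : F n x < √2 + √(((n : ℝ) - 4) / ((n : ℝ) - 3)) := by
      obtain rfl | hx3 : x = 2 ∨ 3 ≤ x := by omega
      · exact F_two_lt hn
      · exact F_lt_of_three_le hn hx3 (by omega)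
    exact ⟨h.le, iff_of_false h.ne (by omega)⟩
end

section
/- Let G be a finite connected simple graph and let uv be a cut edge of G that is not a pendent edge (i.e., each of the two components of G − uv has at least two vertices). If G′ is the graph obtained from G by the edge-lifting transformation on uv, then ABC_GG(G) < ABC_GG(G′). -/
/-- `sideCount G u v` is the number of vertices of `G` whose distance to `u`
is strictly smaller than their distance to `v`. -/
noncomputable def sideCount {V : Type*} [Fintype V] (G : SimpleGraph V) (u v : V) : ℕ :=
  Nat.card {w : V // G.dist w u < G.dist w v}

open Classical in
/-- The Graovac–Ghorbani index
`ABC_GG(G) = Σ_{uv ∈ E(G)} sqrt ((n_u + n_v - 2) / (n_u * n_v))`,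
computed as half the sum over ordered adjacent pairs. -/
noncomputable def ABCGG {V : Type*} [Fintype V] (G : SimpleGraph V) : ℝ :=
  (1 / 2) * ∑ u : V, ∑ v : V,
    if G.Adj u v then
      Real.sqrt (((sideCount G u v : ℝ) + (sideCount G v u : ℝ) - 2) /
        ((sideCount G u v : ℝ) * (sideCount G v u : ℝ)))
    else 0

/-- The edge-lifting transformation on a (non-pendent cut) edge `uv` of `G`:
the edge `uv` is deleted, the vertices `u` and `v` are identified (into `u`),
and a new pendent vertex (reusing the vertex `v`) is attached to the identified
vertex.  The resulting graph has the same number of vertices and edges as `G`. -/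
def edgeLift {V : Type*} (G : SimpleGraph V) (u v : V) : SimpleGraph V :=
  SimpleGraph.fromRel (fun x y =>
    (x = u ∧ y = v) ∨
    (x ≠ v ∧ y ≠ v ∧ (G.Adj x y ∨ (x = u ∧ G.Adj v y) ∨ (y = u ∧ G.Adj v x))))

/-- `A` is the side of `u` when the cut edge `uv` is removed: the edge `uv` is the only edge
of `G` leaving `A`. -/
structure IsBridgeSide {V : Type*} (G : SimpleGraph V) (u v : V) (A : Set V) : Prop where
  connected : G.Connected
  adj : G.Adj u v
  left_mem : u ∈ A
  right_notMem : v ∉ A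
  eq_of_adj : ∀ x y, G.Adj x y → x ∈ A → y ∉ A → x = u ∧ y = v

namespace IsBridgeSide

variable {V : Type*} {G : SimpleGraph V} {u v : V} {A : Set V}

theorem compl (h : IsBridgeSide G u v A) : IsBridgeSide G v u Aᶜ where
  connected := h.connected
  adj := h.adj.symm
  left_mem := h.right_notMem
  right_notMem := fun hu => hu h.left_mem
  eq_of_adj := fun x y hxy hx hy => (h.eq_of_adj y x hxy.symm (not_not.mp hy) hx).symm

theorem of_not_reachable (hconn : G.Connected) (hadj : G.Adj u v)
    (hcut : ¬ (G.deleteEdges {s(u, v)}).Reachable u v) :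
    IsBridgeSide G u v {x | (G.deleteEdges {s(u, v)}).Reachable u x} where
  connected := hconn
  adj := hadj
  left_mem := SimpleGraph.Reachable.refl u
  right_notMem := hcut
  eq_of_adj := by
    intro x y hxy hx hy
    simp only [Set.mem_ofPred_eq] at hx hy
    by_cases he : s(x, y) = s(u, v)
    · rcases Sym2.eq_iff.mp he with h | ⟨rfl, rfl⟩
      · exact h
      · exact absurd hx hcut
    · refine absurd (hx.trans (SimpleGraph.Adj.reachable ?_)) hy
      rw [SimpleGraph.deleteEdges_adj]
      exact ⟨hxy, he⟩

theorem dist_add_one_add_dist_le_length (h : IsBridgeSide G u v A) {x w : V} (p : G.Walk x w)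
    (hx : x ∈ A) (hw : w ∉ A) : G.dist x u + 1 + G.dist v w ≤ p.length := by
  induction p with
  | nil => exact absurd hx hw
  | @cons x c w hxc q ih =>
    rw [SimpleGraph.Walk.length_cons]
    by_cases hc : c ∈ A
    · have h1 := ih hc hw
      have h2 := h.connected.dist_triangle (u := x) (v := c) (w := u)
      have h3 : G.dist x c = 1 := SimpleGraph.dist_eq_one_iff_adj.mpr hxc
      omega
    · obtain ⟨rfl, rfl⟩ := h.eq_of_adj x c hxc hx hc
      have := SimpleGraph.dist_le q
      rw [SimpleGraph.dist_self]
      omega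

theorem dist_eq (h : IsBridgeSide G u v A) {x w : V} (hx : x ∈ A) (hw : w ∉ A) :
    G.dist x w = G.dist x u + 1 + G.dist v w := by
  apply le_antisymm
  · have h1 := h.connected.dist_triangle (u := x) (v := u) (w := w)
    have h2 := h.connected.dist_triangle (u := u) (v := v) (w := w)
    have h3 : G.dist u v = 1 := SimpleGraph.dist_eq_one_iff_adj.mpr h.adj
    omega
  · obtain ⟨p, hp⟩ := h.connected.exists_walk_length_eq_dist x w
    exact hp ▸ h.dist_add_one_add_dist_le_length p hx hw

theorem dist_lt_dist_iff (h : IsBridgeSide G u v A) (w : V) :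
    G.dist w u < G.dist w v ↔ w ∈ A := by
  constructor
  · intro hlt
    by_contra hw
    have := h.compl.dist_eq (x := w) (w := u) hw (fun hu => hu h.left_mem)
    omega
  · intro hw
    have := h.dist_eq hw h.right_notMem
    omega

open Classical in
theorem exists_edgeLift_walk (h : IsBridgeSide G u v A) {a b : V} (p : G.Walk a b) :
    ∃ q : (edgeLift G u v).Walk (if a = v then u else a) (if b = v then u else b),
      q.length + (if a ∈ A ↔ b ∈ A then 0 else 1) ≤ p.length := by
  induction p with
  | nil => exact ⟨.nil, by simp⟩
  | @cons a c b hac q ih =>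
    obtain ⟨r, hr⟩ := ih
    by_cases hside : a ∈ A ↔ c ∈ A
    · have hadj : (edgeLift G u v).Adj (if a = v then u else a) (if c = v then u else c) := by
        have huv := h.adj.ne
        have hA := h.left_mem
        have hB := h.right_notMem
        have hne := hac.ne
        have hsymm := hac.symm
        rw [edgeLift, SimpleGraph.fromRel_adj]
        by_cases hav : a = v
        · have : c ≠ u := by rintro rfl; grind
          grind
        · by_cases hcv : c = v
          · have : a ≠ u := by rintro rfl; grind
            grind
          · grind
      refine ⟨.cons hadj r, ?_⟩
      simp only [SimpleGraph.Walk.length_cons, hside]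
      omega
    · have heq : (if a = v then u else a) = (if c = v then u else c) := by
        have huv := h.adj.ne
        by_cases ha : a ∈ A
        · obtain ⟨rfl, rfl⟩ := h.eq_of_adj a c hac ha (by tauto)
          simp [huv]
        · obtain ⟨rfl, rfl⟩ := h.eq_of_adj c a hac.symm (by tauto) ha
          simp [huv]
      refine ⟨r.copy heq.symm rfl, ?_⟩
      simp only [SimpleGraph.Walk.length_cons, SimpleGraph.Walk.length_copy]
      have hle : (if a ∈ A ↔ b ∈ A then 0 else 1) ≤ 1 := by split_ifs <;> simp
      by_cases hcb : c ∈ A ↔ b ∈ A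
      · rw [if_pos hcb] at hr
        omega
      · have hab : a ∈ A ↔ b ∈ A := by tauto
        simp only [hab, if_true]
        omega

theorem edgeLift_adj (h : G.Adj u v) : (edgeLift G u v).Adj u v := by
  rw [edgeLift, SimpleGraph.fromRel_adj]
  exact ⟨h.ne, by simp⟩

open Classical in
theorem exists_edgeLift_walk_length_le (h : IsBridgeSide G u v A) {x : V} (hx : x ∈ A) (w : V) :
    ∃ q : (edgeLift G u v).Walk x w, q.length ≤
      if w ∈ A then G.dist x w else if w = v then G.dist x u + 1 else G.dist x u + G.dist v w := by
  have hxv : x ≠ v := fun e => h.right_notMem (e ▸ hx)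
  by_cases hwv : w = v
  · subst hwv
    obtain ⟨p, hp⟩ := h.connected.exists_walk_length_eq_dist x u
    obtain ⟨q, hq⟩ := h.exists_edgeLift_walk p
    refine ⟨(q.copy (by simp [hxv]) (by simp [h.adj.ne])).concat (edgeLift_adj h.adj), ?_⟩
    simp only [SimpleGraph.Walk.length_concat, SimpleGraph.Walk.length_copy, h.right_notMem]
    simp only [if_true, if_false]
    omega
  · obtain ⟨p, hp⟩ := h.connected.exists_walk_length_eq_dist x w
    obtain ⟨q, hq⟩ := h.exists_edgeLift_walk p
    refine ⟨q.copy (by simp [hxv]) (by simp [hwv]), ?_⟩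
    rw [SimpleGraph.Walk.length_copy]
    by_cases hw : w ∈ A
    · simp only [hw, hx, if_true] at hq ⊢
      omega
    · have := h.dist_eq hx hw
      simp only [hw, hx, hwv, if_false, iff_false, not_true] at hq ⊢
      omega

open Classical in
theorem le_length_edgeLift_walk (h : IsBridgeSide G u v A) {x : V} {a b : V}
    (p : (edgeLift G u v).Walk a b) :
    (if b ∈ A then G.dist x b else if b = v then G.dist x u + 1 else G.dist x u + G.dist v b) ≤
    (if a ∈ A then G.dist x a else if a = v then G.dist x u + 1 else G.dist x u + G.dist v a)
      + p.length := by
  have hstep (a b y : V) (hab : G.Adj a b) : G.dist y a ≤ G.dist y b + 1 := by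
    have h1 := h.connected.dist_triangle (u := y) (v := b) (w := a)
    have h2 : G.dist b a = 1 := SimpleGraph.dist_eq_one_iff_adj.mpr hab.symm
    omega
  have hone : ∀ b, G.Adj v b → G.dist v b = 1 :=
    fun b hb => SimpleGraph.dist_eq_one_iff_adj.mpr hb
  induction p with
  | nil => simp
  | @cons a c b hac q ih =>
    rw [SimpleGraph.Walk.length_cons]
    suffices hs :
      (if c ∈ A then G.dist x c else if c = v then G.dist x u + 1 else G.dist x u + G.dist v c) ≤
      (if a ∈ A then G.dist x a else if a = v then G.dist x u + 1 else G.dist x u + G.dist v a)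
        + 1 by omega
    rw [edgeLift, SimpleGraph.fromRel_adj] at hac
    have hA := h.left_mem
    have hB := h.right_notMem
    have huv := h.adj.ne
    have hE := h.eq_of_adj
    have hsym : ∀ a b, G.Adj a b → G.Adj b a := fun _ _ e => e.symm
    clear ih
    obtain ⟨hne, hr⟩ := hac
    by_cases ha : a ∈ A <;> by_cases hc : c ∈ A <;> grind

open Classical in
theorem edgeLift_dist (h : IsBridgeSide G u v A) {x : V} (hx : x ∈ A) (w : V) :
    (edgeLift G u v).dist x w =
      if w ∈ A then G.dist x w else if w = v then G.dist x u + 1 else G.dist x u + G.dist v w := by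
  obtain ⟨q, hq⟩ := h.exists_edgeLift_walk_length_le hx w
  apply le_antisymm ((SimpleGraph.dist_le q).trans hq)
  obtain ⟨p, hp⟩ := q.reachable.exists_walk_length_eq_dist
  have := h.le_length_edgeLift_walk (x := x) p
  rw [if_pos hx, SimpleGraph.dist_self, hp, zero_add] at this
  exact this

theorem edgeLift_dist_lt_dist_iff (h : IsBridgeSide G u v A) {x y : V} (hx : x ∈ A) (hy : y ∈ A)
    (w : V) : (edgeLift G u v).dist w x < (edgeLift G u v).dist w y ↔
      G.dist w x < G.dist w y := by
  rw [SimpleGraph.dist_comm (u := w), SimpleGraph.dist_comm (u := w) (v := y),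
    h.edgeLift_dist hx, h.edgeLift_dist hy, SimpleGraph.dist_comm (u := w),
    SimpleGraph.dist_comm (u := w) (v := y)]
  by_cases hw : w ∈ A
  · simp [hw]
  · have h1 := h.dist_eq hx hw
    have h2 := h.dist_eq hy hw
    simp only [hw, if_false]
    split_ifs <;> omega

theorem edgeLift_adj_iff (h : IsBridgeSide G u v A) {x y : V} (hx : x ∈ A) (hy : y ∈ A) :
    (edgeLift G u v).Adj x y ↔ G.Adj x y := by
  have hA := h.left_mem
  have hB := h.right_notMem
  have hE := h.eq_of_adj
  have hsym : ∀ a b, G.Adj a b → G.Adj b a := fun _ _ e => e.symm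
  have hne : G.Adj x y → x ≠ y := fun e => e.ne
  rw [edgeLift, SimpleGraph.fromRel_adj]
  grind

theorem edgeLift_isBridgeSide (h : IsBridgeSide G u v A) :
    IsBridgeSide (edgeLift G u v) u v {v}ᶜ where
  connected := by
    have : Nonempty V := ⟨u⟩
    have hr (w : V) : (edgeLift G u v).Reachable u w :=
      (h.exists_edgeLift_walk_length_le h.left_mem w).elim fun q _ => q.reachable
    exact ⟨fun x y => (hr x).symm.trans (hr y)⟩
  adj := edgeLift_adj h.adj
  left_mem := h.adj.ne
  right_notMem := by simp
  eq_of_adj := by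
    intro x y hxy hx hy
    rw [edgeLift, SimpleGraph.fromRel_adj] at hxy
    simp only [Set.mem_compl_iff, Set.mem_singleton_iff, not_not] at hx hy
    grind

end IsBridgeSide

theorem sideCount_eq_of_iff {V : Type*} [Fintype V] {G H : SimpleGraph V} {x y x' y' : V}
    (e : V ≃ V) (h : ∀ w, G.dist w x < G.dist w y ↔ H.dist (e w) x' < H.dist (e w) y') :
    sideCount G x y = sideCount H x' y' :=
  Nat.card_congr (e.subtypeEquiv h)

open Classical in
/-- The identification of the two edge-liftings along `uv` and along `vu`. -/
noncomputable def edgeLiftSwap {V : Type*} (G : SimpleGraph V) {u v : V} (huv : G.Adj u v) :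
    edgeLift G v u ≃g edgeLift G u v where
  toEquiv := Equiv.swap u v
  map_rel_iff' := by
    intro a b
    have hne := huv.ne
    have hsym : ∀ a b, G.Adj a b → G.Adj b a := fun _ _ e => e.symm
    have hirr : ∀ a, ¬ G.Adj a a := fun a => G.irrefl
    simp only [edgeLift, SimpleGraph.fromRel_adj, Equiv.swap_apply_def]
    by_cases h1 : a = u <;> by_cases h2 : a = v <;> by_cases h3 : b = u <;> by_cases h4 : b = v <;>
      grind

theorem SimpleGraph.Iso.dist_eq {V W : Type*} {G : SimpleGraph V} {H : SimpleGraph W}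
    (e : G ≃g H) (x y : V) : H.dist (e x) (e y) = G.dist x y := by
  by_cases hr : G.Reachable x y
  · apply le_antisymm
    · obtain ⟨p, hp⟩ := hr.exists_walk_length_eq_dist
      simpa [hp] using SimpleGraph.dist_le (p.map e.toHom)
    · obtain ⟨p, hp⟩ := (e.reachable_iff.mpr hr).exists_walk_length_eq_dist
      have := SimpleGraph.dist_le ((p.map e.symm.toHom).copy (e.symm_apply_apply x)
        (e.symm_apply_apply y))
      simpa [hp] using this
  · rw [SimpleGraph.dist_eq_zero_of_not_reachable hr,
      SimpleGraph.dist_eq_zero_of_not_reachable (mt e.reachable_iff.mp hr)]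

open Classical in
/-- The contribution of the ordered pair `(x, y)` to `ABCGG G`. -/
noncomputable def abcTerm {V : Type*} [Fintype V] (G : SimpleGraph V) (x y : V) : ℝ :=
  if G.Adj x y then
    Real.sqrt (((sideCount G x y : ℝ) + (sideCount G y x : ℝ) - 2) /
      ((sideCount G x y : ℝ) * (sideCount G y x : ℝ)))
  else 0

section abcTerm

variable {V : Type*} [Fintype V] {G : SimpleGraph V} {u v : V} {A : Set V}

theorem abcTerm_comm (x y : V) : abcTerm G x y = abcTerm G y x := by
  rw [abcTerm, abcTerm, G.adj_comm x y, add_comm (sideCount G x y : ℝ),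
    mul_comm (sideCount G x y : ℝ)]

theorem abcTerm_of_not_adj {x y : V} (h : ¬ G.Adj x y) : abcTerm G x y = 0 := if_neg h

theorem abcTerm_iso {H : SimpleGraph V} (e : G ≃g H) (x y : V) :
    abcTerm H (e x) (e y) = abcTerm G x y := by
  have hs (x y : V) : sideCount G x y = sideCount H (e x) (e y) :=
    sideCount_eq_of_iff e.toEquiv fun w => by
      change _ ↔ H.dist (e w) (e x) < H.dist (e w) (e y)
      rw [e.dist_eq, e.dist_eq]
  rw [abcTerm, abcTerm, hs x y, hs y x, propext (e.map_adj_iff (v := x) (w := y))]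

theorem IsBridgeSide.abcTerm_edgeLift (h : IsBridgeSide G u v A) {x y : V} (hx : x ∈ A)
    (hy : y ∈ A) : abcTerm (edgeLift G u v) x y = abcTerm G x y := by
  have hs {x y : V} (hx : x ∈ A) (hy : y ∈ A) :
      sideCount (edgeLift G u v) x y = sideCount G x y :=
    sideCount_eq_of_iff (.refl V) (h.edgeLift_dist_lt_dist_iff hx hy)
  rw [abcTerm, abcTerm, hs hx hy, hs hy hx, propext (h.edgeLift_adj_iff hx hy)]

open Classical in
theorem IsBridgeSide.abcTerm_edgeLift_swap (h : IsBridgeSide G u v A) {x y : V} (hx : x ∉ A)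
    (hy : y ∉ A) :
    abcTerm (edgeLift G u v) (Equiv.swap u v x) (Equiv.swap u v y) = abcTerm G x y :=
  (abcTerm_iso (edgeLiftSwap G h.adj) x y).trans (h.compl.abcTerm_edgeLift hx hy)

theorem IsBridgeSide.sideCount_eq (h : IsBridgeSide G u v A) : sideCount G u v = A.ncard :=
  Nat.card_congr (Equiv.subtypeEquivRight h.dist_lt_dist_iff)

theorem IsBridgeSide.abcTerm_eq (h : IsBridgeSide G u v A) :
    abcTerm G u v = Real.sqrt (((A.ncard : ℝ) + (Aᶜ.ncard : ℝ) - 2) /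
      ((A.ncard : ℝ) * (Aᶜ.ncard : ℝ))) := by
  rw [abcTerm, if_pos h.adj, h.sideCount_eq, h.compl.sideCount_eq]

theorem IsBridgeSide.abcTerm_lt_edgeLift (h : IsBridgeSide G u v A) (hA : 2 ≤ A.ncard)
    (hB : 2 ≤ Aᶜ.ncard) : abcTerm G u v < abcTerm (edgeLift G u v) u v := by
  rw [h.abcTerm_eq, h.edgeLift_isBridgeSide.abcTerm_eq, compl_compl, Set.ncard_singleton]
  have h1 := Set.ncard_add_ncard_compl A
  have h2 := Set.ncard_add_ncard_compl ({v} : Set V)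
  rw [Set.ncard_singleton] at h2
  have h3 : (({v}ᶜ : Set V).ncard : ℝ) = A.ncard + Aᶜ.ncard - 1 := by
    have : 1 + ({v}ᶜ : Set V).ncard = A.ncard + Aᶜ.ncard := by omega
    rw [← Nat.cast_add, ← this]
    push_cast
    ring
  rw [h3]
  have hA' : (2 : ℝ) ≤ A.ncard := by exact_mod_cast hA
  have hB' : (2 : ℝ) ≤ Aᶜ.ncard := by exact_mod_cast hB
  generalize (A.ncard : ℝ) = a at *
  generalize (Aᶜ.ncard : ℝ) = b at *
  apply Real.sqrt_lt_sqrt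
  · apply div_nonneg
    · linarith
    · positivity
  · have e : a + b - 1 + ((1 : ℕ) : ℝ) - 2 = a + b - 2 := by push_cast; ring
    rw [e, Nat.cast_one, mul_one]
    apply div_lt_div_of_pos_left
    · linarith
    · linarith
    · nlinarith

end abcTerm

theorem stmt7 {V : Type*} [Fintype V] (G : SimpleGraph V) (u v : V)
    (hconn : G.Connected) (hadj : G.Adj u v)
    (hcut : ¬ (G.deleteEdges {s(u, v)}).Reachable u v)
    (hu : ∃ x, x ≠ u ∧ (G.deleteEdges {s(u, v)}).Reachable u x)
    (hv : ∃ y, y ≠ v ∧ (G.deleteEdges {s(u, v)}).Reachable v y) :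
    ABCGG G < ABCGG (edgeLift G u v) := by
  classical
  have h := IsBridgeSide.of_not_reachable hconn hadj hcut
  set A : Set V := {x | (G.deleteEdges {s(u, v)}).Reachable u x}
  have hA2 : 2 ≤ A.ncard := by
    obtain ⟨x, hxu, hx⟩ := hu
    exact (Set.one_lt_ncard (Set.toFinite A)).mpr ⟨x, hx, u, h.left_mem, hxu⟩
  have hB2 : 2 ≤ Aᶜ.ncard := by
    obtain ⟨y, hyv, hy⟩ := hv
    exact (Set.one_lt_ncard (Set.toFinite Aᶜ)).mpr
      ⟨y, fun hyA => hcut (SimpleGraph.Reachable.trans hyA hy.symm), v, h.right_notMem, hyv⟩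
  have hlt := h.abcTerm_lt_edgeLift hA2 hB2
  set H := edgeLift G u v with hH
  set σ : Equiv.Perm V := Equiv.swap u v
  have hmem := h.left_mem
  have hnot := h.right_notMem
  have hne := hadj.ne
  have hE := h.eq_of_adj
  have hE' := h.edgeLift_isBridgeSide.eq_of_adj
  have hsym : ∀ x y, G.Adj x y → G.Adj y x := fun _ _ e => e.symm
  have hGsplit (x y : V) : abcTerm G x y = (if x ∈ A ∧ y ∈ A then abcTerm G x y else 0) +
      (if x ∉ A ∧ y ∉ A then abcTerm G x y else 0) +
      (if x = u ∧ y = v then abcTerm G u v else 0) +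
      (if x = v ∧ y = u then abcTerm G u v else 0) := by
    have h0 : ¬ G.Adj x y → abcTerm G x y = 0 := abcTerm_of_not_adj
    have h1 := abcTerm_comm (G := G) u v
    by_cases hx : x ∈ A <;> by_cases hy : y ∈ A <;> grind
  have hHsplit (x y : V) : abcTerm H x y = (if x ∈ A ∧ y ∈ A then abcTerm G x y else 0) +
      (if σ x ∉ A ∧ σ y ∉ A then abcTerm G (σ x) (σ y) else 0) +
      (if x = u ∧ y = v then abcTerm H u v else 0) +
      (if x = v ∧ y = u then abcTerm H u v else 0) := by
    have h0 : ¬ H.Adj x y → abcTerm H x y = 0 := abcTerm_of_not_adj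
    have hG0 (z : V) : abcTerm G z z = 0 := abcTerm_of_not_adj G.irrefl
    have hH0 (z : V) : abcTerm H z z = 0 := abcTerm_of_not_adj H.irrefl
    have h1 := abcTerm_comm (G := H) u v
    have hHA : x ∈ A → y ∈ A → abcTerm H x y = abcTerm G x y := h.abcTerm_edgeLift
    have hHB : σ x ∉ A → σ y ∉ A → abcTerm H x y = abcTerm G (σ x) (σ y) := by
      intro hx hy
      simpa [σ] using h.abcTerm_edgeLift_swap hx hy
    have hmix : x ∈ A → y ∉ A → y ≠ v → H.Adj x y → x = u := by
      intro hx hy hyv hxy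
      rw [hH, edgeLift, SimpleGraph.fromRel_adj] at hxy
      grind
    have hmix' : y ∈ A → x ∉ A → x ≠ v → H.Adj x y → y = u := by
      intro hy hx hxv hxy
      rw [hH, edgeLift, SimpleGraph.fromRel_adj] at hxy
      grind
    have hv1 : y = v → x ≠ v → H.Adj x y → x = u := by
      rintro rfl hxv hxy
      exact (hE' x y hxy hxv (by simp)).1
    have hv2 : x = v → y ≠ v → H.Adj x y → y = u := by
      rintro rfl hyv hxy
      exact (hE' y x hxy.symm hyv (by simp)).1
    have hσx : σ x = if x = u then v else if x = v then u else x := Equiv.swap_apply_def ..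
    have hσy : σ y = if y = u then v else if y = v then u else y := Equiv.swap_apply_def ..
    clear_value σ H
    clear hE' hlt hE hsym hGsplit
    by_cases hxu : x = u <;> by_cases hxv : x = v <;> by_cases hyu : y = u <;>
      by_cases hyv : y = v <;> grind
  have hσ : ∑ x, ∑ y, (if σ x ∉ A ∧ σ y ∉ A then abcTerm G (σ x) (σ y) else 0) =
      ∑ x, ∑ y, (if x ∉ A ∧ y ∉ A then abcTerm G x y else 0) := by
    rw [← Equiv.sum_comp σ (fun x => ∑ y, (if x ∉ A ∧ y ∉ A then abcTerm G x y else 0))]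
    exact Finset.sum_congr rfl fun x _ =>
      Equiv.sum_comp σ (fun y => if σ x ∉ A ∧ y ∉ A then abcTerm G (σ x) y else 0)
  have hpair (a b : V) (c : ℝ) : ∑ x, ∑ y, (if x = a ∧ y = b then c else 0) = c := by
    simp [ite_and]
  have hGsum := Finset.sum_congr rfl fun x (_ : x ∈ Finset.univ) =>
    Finset.sum_congr rfl fun y (_ : y ∈ Finset.univ) => hGsplit x y
  have hHsum := Finset.sum_congr rfl fun x (_ : x ∈ Finset.univ) =>
    Finset.sum_congr rfl fun y (_ : y ∈ Finset.univ) => hHsplit x y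
  simp only [Finset.sum_add_distrib, hpair, hσ] at hGsum hHsum
  have hG : ABCGG G = 1 / 2 * ∑ x, ∑ y, abcTerm G x y := rfl
  have hH' : ABCGG H = 1 / 2 * ∑ x, ∑ y, abcTerm H x y := rfl
  rw [hG, hH', hGsum, hHsum]
  linarith
end

section
/- Fix n and suppose G = S_n^{3,3}(m_1, m_2, n_1, n_2, m_0) attains the maximal Graovac–Ghorbani index ABC_GG among all graphs of the form S_n^{3,3}(m_1′, m_2′, n_1′, n_2′, m_0′) of order n. Then min{m_1, m_2} = 0 and min{n_1, n_2} = 0. -/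
/-- Vertex type for `S_n^{3,3}(m1,m2,n1,n2,m0)`: the five cycle vertices
(`0` = common vertex `u`, `1,2` = the other vertices of the first triangle,
`3,4` = the other vertices of the second triangle) together with the pendent
vertices. -/
abbrev SVert (m1 m2 n1 n2 m0 : ℕ) : Type :=
  Fin 5 ⊕ Fin m1 ⊕ Fin m2 ⊕ Fin n1 ⊕ Fin n2 ⊕ Fin m0

/-- The graph `S_n^{3,3}(m1,m2,n1,n2,m0)`: two triangles sharing exactly the vertex `u`,
with `m1, m2` pendent vertices attached to the two non-common vertices of the first
triangle, `n1, n2` pendent vertices attached to those of the second triangle, and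
`m0` pendent vertices attached to `u`.  `S_n^{3,3}(m1,n1,m0)` is `S33 m1 0 n1 0 m0`. -/
def S33 (m1 m2 n1 n2 m0 : ℕ) : SimpleGraph (SVert m1 m2 n1 n2 m0) :=
  SimpleGraph.fromRel (fun x y =>
    (x = Sum.inl 0 ∧ y = Sum.inl 1) ∨
    (x = Sum.inl 1 ∧ y = Sum.inl 2) ∨
    (x = Sum.inl 2 ∧ y = Sum.inl 0) ∨
    (x = Sum.inl 0 ∧ y = Sum.inl 3) ∨
    (x = Sum.inl 3 ∧ y = Sum.inl 4) ∨
    (x = Sum.inl 4 ∧ y = Sum.inl 0) ∨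
    (∃ i : Fin m1, x = Sum.inl 1 ∧ y = Sum.inr (Sum.inl i)) ∨
    (∃ i : Fin m2, x = Sum.inl 2 ∧ y = Sum.inr (Sum.inr (Sum.inl i))) ∨
    (∃ i : Fin n1, x = Sum.inl 3 ∧ y = Sum.inr (Sum.inr (Sum.inr (Sum.inl i)))) ∨
    (∃ i : Fin n2, x = Sum.inl 4 ∧ y = Sum.inr (Sum.inr (Sum.inr (Sum.inr (Sum.inl i))))) ∨
    (∃ i : Fin m0, x = Sum.inl 0 ∧ y = Sum.inr (Sum.inr (Sum.inr (Sum.inr (Sum.inr i))))))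

theorem SimpleGraph.dist_eq_of_potential {V : Type*} (G : SimpleGraph V) (v : V) (d : V → ℕ)
    (h0 : d v = 0) (hdesc : ∀ x, x ≠ v → ∃ y, G.Adj x y ∧ d x = d y + 1)
    (hlip : ∀ x y, G.Adj x y → d x ≤ d y + 1) (x : V) : G.dist x v = d x := by
  have hle : ∀ {x y : V} (p : G.Walk x y), d x ≤ d y + p.length := by
    intro x y p
    induction p with
    | nil => simp
    | cons h p ih =>
      have := hlip _ _ h
      rw [SimpleGraph.Walk.length_cons]
      omega
  have hex : ∀ (k : ℕ) (x : V), d x = k → ∃ p : G.Walk x v, p.length = k := by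
    intro k
    induction k with
    | zero =>
      intro x hx
      by_cases hxv : x = v
      · subst hxv
        exact ⟨.nil, rfl⟩
      · obtain ⟨y, -, hy⟩ := hdesc x hxv
        omega
    | succ k ih =>
      intro x hx
      have hxv : x ≠ v := by
        rintro rfl
        omega
      obtain ⟨y, hxy, hy⟩ := hdesc x hxv
      obtain ⟨p, hp⟩ := ih y (by omega)
      exact ⟨.cons hxy p, by simp [hp]⟩
  obtain ⟨p, hp⟩ := hex _ x rfl
  obtain ⟨q, hq⟩ := p.reachable.exists_walk_length_eq_dist
  have h1 := SimpleGraph.dist_le p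
  have h2 := hle q
  omega

/-- Adjacency in the graph made of the triangles `0, 1, 2` and `0, 3, 4`. -/
abbrev coreAdj (i j : Fin 5) : Prop :=
  i ≠ j ∧ (i = 0 ∨ j = 0 ∨ (i ≤ 2 ↔ j ≤ 2))

/-- The distance in the graph made of the triangles `0, 1, 2` and `0, 3, 4`. -/
def coreDist (i j : Fin 5) : ℕ :=
  if i = j then 0 else if coreAdj i j then 1 else 2

/-- The pendent vertices of `S33 m1 m2 n1 n2 m0`. -/
abbrev Leaf (m1 m2 n1 n2 m0 : ℕ) : Type :=
  Fin m1 ⊕ Fin m2 ⊕ Fin n1 ⊕ Fin n2 ⊕ Fin m0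

section Graph

variable {m1 m2 n1 n2 m0 : ℕ}

/-- The cycle vertex to which a pendent vertex is attached. -/
def leafRoot : Leaf m1 m2 n1 n2 m0 → Fin 5
  | .inl _ => 1
  | .inr (.inl _) => 2
  | .inr (.inr (.inl _)) => 3
  | .inr (.inr (.inr (.inl _))) => 4
  | .inr (.inr (.inr (.inr _))) => 0

/-- The nearest cycle vertex. -/
def root : SVert m1 m2 n1 n2 m0 → Fin 5
  | .inl i => i
  | .inr y => leafRoot y

/-- The distance to the nearest cycle vertex. -/
def depth : SVert m1 m2 n1 n2 m0 → ℕ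
  | .inl _ => 0
  | .inr _ => 1

theorem S33_adj_inl_inl (i j : Fin 5) :
    (S33 m1 m2 n1 n2 m0).Adj (.inl i) (.inl j) ↔ coreAdj i j := by
  fin_cases i <;> fin_cases j <;> simp [S33, coreAdj]

theorem S33_adj_inl_inr (i : Fin 5) (y : Leaf m1 m2 n1 n2 m0) :
    (S33 m1 m2 n1 n2 m0).Adj (.inl i) (.inr y) ↔ i = leafRoot y := by
  rcases y with y | y | y | y | y <;> simp [S33, leafRoot]

theorem S33_adj_inr_inl (i : Fin 5) (y : Leaf m1 m2 n1 n2 m0) :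
    (S33 m1 m2 n1 n2 m0).Adj (.inr y) (.inl i) ↔ i = leafRoot y := by
  rw [SimpleGraph.adj_comm, S33_adj_inl_inr]

theorem S33_not_adj_inr_inr (x y : Leaf m1 m2 n1 n2 m0) :
    ¬ (S33 m1 m2 n1 n2 m0).Adj (.inr x) (.inr y) := by
  simp [S33]

theorem coreDist_self (i : Fin 5) : coreDist i i = 0 := by simp [coreDist]

theorem coreDist_le_of_coreAdj : ∀ i j k : Fin 5, coreAdj i j →
    coreDist i k ≤ coreDist j k + 1 := by decide

theorem exists_coreAdj_coreDist : ∀ i k : Fin 5, i ≠ k →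
    ∃ j, coreAdj i j ∧ coreDist i k = coreDist j k + 1 := by decide

theorem S33_dist_inl (i : Fin 5) (w : SVert m1 m2 n1 n2 m0) :
    (S33 m1 m2 n1 n2 m0).dist w (.inl i) = depth w + coreDist (root w) i := by
  refine SimpleGraph.dist_eq_of_potential _ (.inl i)
    (fun w => depth w + coreDist (root w) i) ?_ ?_ ?_ w
  · simp [depth, root, coreDist_self]
  · rintro (k | y) hk
    · obtain ⟨j, hj, hd⟩ := exists_coreAdj_coreDist k i (by simpa using hk)
      exact ⟨.inl j, (S33_adj_inl_inl _ _).2 hj, by simp [depth, root, hd]⟩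
    · exact ⟨.inl (leafRoot y), (S33_adj_inr_inl _ _).2 rfl, by simp [depth, root, add_comm]⟩
  · rintro (j | x) (k | y) h
    · simpa [depth, root] using coreDist_le_of_coreAdj _ _ _ ((S33_adj_inl_inl _ _).1 h)
    · simp only [(S33_adj_inl_inr _ _).1 h, depth, root]
      omega
    · simp only [(S33_adj_inr_inl _ _).1 h, depth, root]
      omega
    · exact absurd h (S33_not_adj_inr_inr _ _)

theorem S33_dist_inr (y : Leaf m1 m2 n1 n2 m0) (w : SVert m1 m2 n1 n2 m0) :
    (S33 m1 m2 n1 n2 m0).dist w (.inr y) =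
      if w = .inr y then 0 else depth w + coreDist (root w) (leafRoot y) + 1 := by
  refine SimpleGraph.dist_eq_of_potential _ (.inr y)
    (fun w => if w = .inr y then 0 else depth w + coreDist (root w) (leafRoot y) + 1) ?_ ?_ ?_ w
  · simp
  · rintro (k | x) hx
    · by_cases hk : k = leafRoot y
      · exact ⟨.inr y, (S33_adj_inl_inr _ _).2 hk, by simp [depth, root, hk, coreDist_self]⟩
      · obtain ⟨j, hj, hd⟩ := exists_coreAdj_coreDist k (leafRoot y) hk
        exact ⟨.inl j, (S33_adj_inl_inl _ _).2 hj, by simp [depth, root, hd]⟩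
    · exact ⟨.inl (leafRoot x), (S33_adj_inr_inl _ _).2 rfl, by
        simp [depth, root, hx, add_comm]⟩
  · rintro (j | x) (k | z) h
    · simpa [depth, root] using coreDist_le_of_coreAdj _ _ _ ((S33_adj_inl_inl _ _).1 h)
    · obtain rfl := (S33_adj_inl_inr _ _).1 h
      by_cases hz : z = y
      · simp [depth, root, hz, coreDist_self]
      · simp only [reduceCtorEq, Sum.inr.injEq, hz, depth, root, if_false]
        omega
    · obtain rfl := (S33_adj_inr_inl _ _).1 h
      by_cases hx : x = y
      · simp [hx]
      · simp only [reduceCtorEq, Sum.inr.injEq, hx, depth, root, if_false]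
        omega
    · exact absurd h (S33_not_adj_inr_inr _ _)

theorem sum_comp_root (g : Fin 5 → ℕ) :
    ∑ w : SVert m1 m2 n1 n2 m0, g (root w) =
      ∑ k, g k + (m1 * g 1 + (m2 * g 2 + (n1 * g 3 + (n2 * g 4 + m0 * g 0)))) := by
  simp only [Fintype.sum_sum_type, root, leafRoot, Finset.sum_const, Finset.card_univ,
    Fintype.card_fin, smul_eq_mul]

theorem sideCount_S33_inl_inl (i j : Fin 5) :
    sideCount (S33 m1 m2 n1 n2 m0) (.inl i) (.inl j) =
      (∑ k : Fin 5, if coreDist k i < coreDist k j then 1 else 0) +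
      ((if coreDist 1 i < coreDist 1 j then m1 else 0) +
      ((if coreDist 2 i < coreDist 2 j then m2 else 0) +
      ((if coreDist 3 i < coreDist 3 j then n1 else 0) +
      ((if coreDist 4 i < coreDist 4 j then n2 else 0) +
      (if coreDist 0 i < coreDist 0 j then m0 else 0))))) := by
  simp only [sideCount, S33_dist_inl, add_lt_add_iff_left]
  rw [Nat.card_eq_fintype_card, Fintype.card_subtype, Finset.card_filter]
  rw [sum_comp_root fun k => if coreDist k i < coreDist k j then 1 else 0]
  simp only [mul_ite, mul_one, mul_zero]

theorem sideCount_S33_inr_inl (y : Leaf m1 m2 n1 n2 m0) :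
    sideCount (S33 m1 m2 n1 n2 m0) (.inr y) (.inl (leafRoot y)) = 1 := by
  have h : ∀ w : SVert m1 m2 n1 n2 m0,
      ((S33 m1 m2 n1 n2 m0).dist w (.inr y) < (S33 m1 m2 n1 n2 m0).dist w (.inl (leafRoot y))) ↔
        w = .inr y := by
    intro w
    rw [S33_dist_inl, S33_dist_inr]
    by_cases hw : w = .inr y
    · simp [hw, depth]
    · simp only [hw, if_false, iff_false]
      omega
  simp [sideCount, h]

theorem sideCount_S33_inl_inr (y : Leaf m1 m2 n1 n2 m0) :
    sideCount (S33 m1 m2 n1 n2 m0) (.inl (leafRoot y)) (.inr y) =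
      m1 + m2 + n1 + n2 + m0 + 4 := by
  classical
  have h : ∀ w : SVert m1 m2 n1 n2 m0,
      ((S33 m1 m2 n1 n2 m0).dist w (.inl (leafRoot y)) < (S33 m1 m2 n1 n2 m0).dist w (.inr y)) ↔
        w ≠ .inr y := by
    intro w
    rw [S33_dist_inl, S33_dist_inr]
    by_cases hw : w = .inr y
    · simp [hw]
    · simp only [hw, if_false, ne_eq, not_false_eq_true, iff_true]
      omega
  rw [sideCount, Nat.subtype_card (Finset.univ.erase (.inr y)) (by simp [h]),
    Finset.card_erase_of_mem (Finset.mem_univ _), Finset.card_univ]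
  simp only [Fintype.card_sum, Fintype.card_fin]
  omega

end Graph

/-- The contribution to `ABCGG` of an edge whose ends have `x` and `y` closer vertices. -/
noncomputable def edgeWeight (x y : ℝ) : ℝ := Real.sqrt ((x + y - 2) / (x * y))

theorem edgeWeight_comm (x y : ℝ) : edgeWeight x y = edgeWeight y x := by
  rw [edgeWeight, edgeWeight, add_comm, mul_comm]

/-- The contribution to `ABCGG` of a triangle. -/
noncomputable def triangleWeight (a b c : ℝ) : ℝ :=
  edgeWeight a b + edgeWeight a c + edgeWeight b c

theorem ABCGG_S33 (m1 m2 n1 n2 m0 : ℕ) :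
    ABCGG (S33 m1 m2 n1 n2 m0) =
      (m1 + m2 + n1 + n2 + m0 : ℕ) * edgeWeight 1 (m1 + m2 + n1 + n2 + m0 + 4 : ℕ) +
      triangleWeight (m1 + 1) (m2 + 1) (n1 + n2 + m0 + 3) +
      triangleWeight (n1 + 1) (n2 + 1) (m1 + m2 + m0 + 3) := by
  classical
  have hcore : ∀ i j : Fin 5, (if (S33 m1 m2 n1 n2 m0).Adj (.inl i) (.inl j) then
      edgeWeight (sideCount (S33 m1 m2 n1 n2 m0) (.inl i) (.inl j))
        (sideCount (S33 m1 m2 n1 n2 m0) (.inl j) (.inl i)) else 0) =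
      if coreAdj i j then
      edgeWeight (sideCount (S33 m1 m2 n1 n2 m0) (.inl i) (.inl j))
        (sideCount (S33 m1 m2 n1 n2 m0) (.inl j) (.inl i)) else 0 := by
    intro i j
    simp only [S33_adj_inl_inl]
  have hleaf : ∀ (i : Fin 5) (y : Leaf m1 m2 n1 n2 m0),
      (if (S33 m1 m2 n1 n2 m0).Adj (.inl i) (.inr y) then
      edgeWeight (sideCount (S33 m1 m2 n1 n2 m0) (.inl i) (.inr y))
        (sideCount (S33 m1 m2 n1 n2 m0) (.inr y) (.inl i)) else 0) =
      if i = leafRoot y then edgeWeight 1 (m1 + m2 + n1 + n2 + m0 + 4 : ℕ) else 0 := by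
    intro i y
    simp only [S33_adj_inl_inr]
    split_ifs with h
    · rw [h, sideCount_S33_inl_inr, sideCount_S33_inr_inl, edgeWeight_comm, Nat.cast_one]
    · rfl
  have hleaf' : ∀ (i : Fin 5) (y : Leaf m1 m2 n1 n2 m0),
      (if (S33 m1 m2 n1 n2 m0).Adj (.inr y) (.inl i) then
      edgeWeight (sideCount (S33 m1 m2 n1 n2 m0) (.inr y) (.inl i))
        (sideCount (S33 m1 m2 n1 n2 m0) (.inl i) (.inr y)) else 0) =
      if i = leafRoot y then edgeWeight 1 (m1 + m2 + n1 + n2 + m0 + 4 : ℕ) else 0 := by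
    intro i y
    rw [edgeWeight_comm, SimpleGraph.adj_comm, hleaf]
  have hsum : ABCGG (S33 m1 m2 n1 n2 m0) = (1 / 2) *
      ((∑ i : Fin 5, ∑ j : Fin 5, if coreAdj i j then
        edgeWeight (sideCount (S33 m1 m2 n1 n2 m0) (.inl i) (.inl j))
          (sideCount (S33 m1 m2 n1 n2 m0) (.inl j) (.inl i)) else 0) +
      2 * ((m1 + m2 + n1 + n2 + m0 : ℕ) *
        edgeWeight 1 (m1 + m2 + n1 + n2 + m0 + 4 : ℕ))) := by
    have hcard : Fintype.card (Leaf m1 m2 n1 n2 m0) = m1 + m2 + n1 + n2 + m0 := by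
      simp only [Fintype.card_sum, Fintype.card_fin]
      omega
    unfold ABCGG
    have hw : ∀ x y : ℝ, Real.sqrt ((x + y - 2) / (x * y)) = edgeWeight x y := fun _ _ => rfl
    simp_rw [hw]
    rw [Fintype.sum_sum_type]
    simp_rw [Fintype.sum_sum_type (α₁ := Fin 5) (α₂ := Leaf m1 m2 n1 n2 m0), hcore, hleaf, hleaf',
      S33_not_adj_inr_inr, Finset.sum_add_distrib]
    rw [Finset.sum_comm (s := (Finset.univ : Finset (Fin 5)))
      (t := (Finset.univ : Finset (Leaf m1 m2 n1 n2 m0)))]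
    simp only [Finset.sum_ite_eq', Finset.mem_univ, if_true, if_false, Finset.sum_const,
      Finset.card_univ, hcard, nsmul_eq_mul, mul_zero]
    ring
  rw [hsum]
  simp only [sideCount_S33_inl_inl, Fin.sum_univ_five]
  simp [coreDist, coreAdj, triangleWeight]
  rw [edgeWeight_comm (3 + (n1 + (n2 + m0))) (1 + m1),
    edgeWeight_comm (3 + (n1 + (n2 + m0))) (1 + m2),
    edgeWeight_comm (3 + (m1 + (m2 + m0))) (1 + n1),
    edgeWeight_comm (3 + (m1 + (m2 + m0))) (1 + n2),
    edgeWeight_comm (1 + m2) (1 + m1), edgeWeight_comm (1 + n2) (1 + n1)]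
  ring_nf

theorem add_sub_one_lt_mul {a b : ℝ} (ha : 1 < a) (hb : 1 < b) : a + b - 1 < a * b := by
  nlinarith

theorem edgeWeight_lt_edgeWeight_one {a b : ℝ} (ha : 1 < a) (hb : 1 < b) :
    edgeWeight a b < edgeWeight (a + b - 1) 1 := by
  have h := add_sub_one_lt_mul ha hb
  refine Real.sqrt_lt_sqrt (div_nonneg (by linarith) (by positivity)) ?_
  have e : a + b - 1 + 1 - 2 = a + b - 2 := by ring
  rw [e, mul_one]
  exact div_lt_div_of_pos_left (by linarith) (by linarith) h

theorem edgeWeight_add_le {a b c : ℝ} (ha : 1 < a) (hb : 1 < b) (hc : 2 ≤ c) :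
    edgeWeight a c + edgeWeight b c ≤ edgeWeight (a + b - 1) c + edgeWeight 1 c := by
  have h := (add_sub_one_lt_mul ha hb).le
  have hs : 0 < a + b - 1 := by linarith
  have hab : 0 < a * b := by positivity
  have hc0 : 0 < c := by linarith
  have hα : 0 ≤ 1 / c := by positivity
  have hβ : 0 ≤ 1 - 2 / c := by
    rw [sub_nonneg, div_le_one hc0]
    exact hc
  have form : ∀ x : ℝ, 0 < x → (x + c - 2) / (x * c) = 1 / c + (1 - 2 / c) * (1 / x) := by
    intro x hx
    field_simp
    ring
  have hinv : 1 / (a * b) ≤ 1 / (a + b - 1) := one_div_le_one_div_of_le hs h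
  simp only [edgeWeight]
  rw [form a (by linarith), form b (by linarith), form _ hs, form 1 one_pos]
  generalize 1 / c = α at *
  generalize 1 - 2 / c = β at *
  have hX : ∀ x : ℝ, 0 < x → 0 ≤ α + β * (1 / x) := fun x hx => by positivity
  have hXa := hX a (by linarith)
  have hXb := hX b (by linarith)
  have hXs := hX _ hs
  have hX1 := hX 1 one_pos
  have e1 : 1 / a + 1 / b = (a + b) * (1 / (a * b)) := by field_simp; ring
  have e2 : 1 / (a + b - 1) + 1 / 1 = (a + b) * (1 / (a + b - 1)) := by field_simp; ring
  have e3 : 1 / a * (1 / b) = 1 / (a * b) := by field_simp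
  have hsum : 1 / a + 1 / b ≤ 1 / (a + b - 1) + 1 / 1 := by
    rw [e1, e2]
    exact mul_le_mul_of_nonneg_left hinv (by linarith)
  have hprod : (α + β * (1 / a)) * (α + β * (1 / b)) ≤
      (α + β * (1 / (a + b - 1))) * (α + β * (1 / 1)) := by
    have := mul_le_mul_of_nonneg_left hsum (mul_nonneg hα hβ)
    have := mul_le_mul_of_nonneg_left (e3.le.trans hinv) (mul_nonneg hβ hβ)
    linarith
  have hsqrt := Real.sqrt_le_sqrt hprod
  rw [Real.sqrt_mul hXa, Real.sqrt_mul hXs] at hsqrt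
  refine le_of_sq_le_sq ?_ (by positivity)
  have := mul_le_mul_of_nonneg_left hsum hβ
  rw [add_sq, add_sq, Real.sq_sqrt hXa, Real.sq_sqrt hXb, Real.sq_sqrt hXs, Real.sq_sqrt hX1]
  linarith

theorem triangleWeight_lt {a b c : ℝ} (ha : 1 < a) (hb : 1 < b) (hc : 2 ≤ c) :
    triangleWeight a b c < triangleWeight (a + b - 1) 1 c := by
  have h1 := edgeWeight_lt_edgeWeight_one ha hb
  have h2 := edgeWeight_add_le ha hb hc
  simp only [triangleWeight]
  linarith

theorem triangleWeight_natCast_lt {m k : ℕ} {c : ℝ} (hm : m ≠ 0) (hk : k ≠ 0) (hc : 2 ≤ c) :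
    triangleWeight (m + 1) (k + 1) c < triangleWeight ((m + k : ℕ) + 1) ((0 : ℕ) + 1) c := by
  have hm' : (0 : ℝ) < m := by positivity
  have hk' : (0 : ℝ) < k := by positivity
  have h := triangleWeight_lt (a := m + 1) (b := k + 1) (by linarith) (by linarith) hc
  convert h using 2
  · push_cast
    ring
  · simp

theorem stmt9 (n m1 m2 n1 n2 m0 : ℕ) (hn : m1 + m2 + n1 + n2 + m0 + 5 = n)
    (hmax : ∀ m1' m2' n1' n2' m0' : ℕ, m1' + m2' + n1' + n2' + m0' + 5 = n →
      ABCGG (S33 m1' m2' n1' n2' m0') ≤ ABCGG (S33 m1 m2 n1 n2 m0)) :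
    min m1 m2 = 0 ∧ min n1 n2 = 0 := by
  constructor
  · by_contra h
    have hlt := triangleWeight_natCast_lt (m := m1) (k := m2) (c := n1 + n2 + m0 + 3)
      (by omega) (by omega) (by norm_cast; omega)
    have hle := hmax (m1 + m2) 0 n1 n2 m0 (by omega)
    rw [ABCGG_S33, ABCGG_S33] at hle
    simp only [add_zero, Nat.cast_add, Nat.cast_zero] at hle hlt
    linarith
  · by_contra h
    have hlt := triangleWeight_natCast_lt (m := n1) (k := n2) (c := m1 + m2 + m0 + 3)
      (by omega) (by omega) (by norm_cast; omega)
    have hle := hmax m1 m2 (n1 + n2) 0 m0 (by omega)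
    rw [ABCGG_S33, ABCGG_S33] at hle
    simp only [add_zero, Nat.cast_add, Nat.cast_zero, ← add_assoc] at hle hlt
    linarith
end

section
/- Let G ∈ S_n^{r,t} be a connected bicyclic graph of order n = 6 whose two cycles have lengths r and t and share exactly one common vertex. Then ABC_GG(G) ≤ sqrt(3) + sqrt(2) + sqrt(2/3) + sqrt(4/5), with equality if and only if G = S_6^{3,3}(1, 0, 0). -/
/-- `G ∈ S_n^{r,t}`: `G` is a bicyclic graph of order `n` possessing two cycles, of
lengths `r` and `t`, sharing exactly one common vertex. -/
def InSnrt {V : Type*} [Fintype V] (G : SimpleGraph V) (n r t : ℕ) : Prop :=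
  Fintype.card V = n ∧ G.Connected ∧ G.edgeSet.ncard = n + 1 ∧
  ∃ (a b : V) (c1 : G.Walk a a) (c2 : G.Walk b b),
    c1.IsCycle ∧ c2.IsCycle ∧ c1.length = r ∧ c2.length = t ∧
    ({v | v ∈ c1.support} ∩ {v | v ∈ c2.support}).ncard = 1

namespace SimpleGraph

variable {V W : Type*}

lemma dist_eq_of_forall {G : SimpleGraph V} (d : V → V → ℕ)
    (hself : ∀ u, d u u = 0)
    (hadj : ∀ u v w, G.Adj v w → d u w ≤ d u v + 1)
    (hpred : ∀ u v, u = v ∨ ∃ w, G.Adj w v ∧ d u v = d u w + 1) (u v : V) :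
    G.dist u v = d u v := by
  have hwalk : ∀ n v, d u v = n → ∃ p : G.Walk u v, p.length = n := by
    intro n
    induction n with
    | zero =>
      intro v hv
      by_cases h : u = v
      · subst h; exact ⟨.nil, rfl⟩
      · obtain ⟨w, -, hw⟩ := (hpred u v).resolve_left h
        omega
    | succ n ih =>
      intro v hv
      have h : u ≠ v := by
        rintro rfl
        simp [hself] at hv
      obtain ⟨w, hwv, hw⟩ := (hpred u v).resolve_left h
      obtain ⟨p, hp⟩ := ih w (by omega)
      exact ⟨p.concat hwv, by simp [hp]⟩
  have hle : ∀ {x y : V} (p : G.Walk x y), d u y ≤ d u x + p.length := by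
    intro x y p
    induction p with
    | nil => simp
    | cons h p ih =>
      have := hadj u _ _ h
      simp only [Walk.length_cons]
      omega
  obtain ⟨p, hp⟩ := hwalk _ v rfl
  refine le_antisymm (hp ▸ dist_le p) ?_
  obtain ⟨q, hq⟩ := (p.reachable).exists_walk_length_eq_dist
  have := hle q
  rw [hself, hq] at this
  omega

lemma nonempty_iso_of_hom_bijective [Finite V] {G : SimpleGraph V} {H : SimpleGraph W}
    (f : H →g G) (hf : Function.Bijective f)
    (hcard : G.edgeSet.ncard ≤ H.edgeSet.ncard) : Nonempty (G ≃g H) := by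
  let e : W ≃ V := Equiv.ofBijective f hf
  have hle : H.map e.toEmbedding ≤ G := by
    rintro _ _ ⟨-, x, y, h, rfl, rfl⟩
    exact f.map_adj h
  have hEq : H.map e.toEmbedding = G := by
    rw [← edgeSet_inj]
    refine Set.eq_of_subset_of_ncard_le (edgeSet_subset_edgeSet.2 hle) ?_ (Set.toFinite _)
    rw [edgeSet_map, Set.ncard_image_of_injective _ (Function.Embedding.injective _)]
    exact hcard
  exact ⟨(hEq ▸ Iso.map e H).symm⟩

lemma Reachable.dist_map_le {G : SimpleGraph V} {H : SimpleGraph W} {u v : V}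
    (h : G.Reachable u v) (f : G →g H) : H.dist (f u) (f v) ≤ G.dist u v := by
  obtain ⟨p, hp⟩ := h.exists_walk_length_eq_dist
  simpa [hp] using dist_le (p.map f)

lemma Iso.dist_eq_s10 {G : SimpleGraph V} {H : SimpleGraph W} (e : G ≃g H) (u v : V) :
    H.dist (e u) (e v) = G.dist u v := by
  by_cases h : G.Reachable u v
  · refine le_antisymm (h.dist_map_le e.toHom) ?_
    simpa using ((Iso.reachable_iff (φ := e)).2 h).dist_map_le e.symm.toHom
  · rw [dist_eq_zero_of_not_reachable h,
      dist_eq_zero_of_not_reachable (mt (Iso.reachable_iff (φ := e)).1 h)]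

end SimpleGraph

open SimpleGraph

section Index

variable {V W : Type*} [Fintype V] [Fintype W]

lemma sideCount_iso {G : SimpleGraph V} {H : SimpleGraph W} (e : G ≃g H) (u v : V) :
    sideCount H (e u) (e v) = sideCount G u v := by
  refine (Nat.card_congr (e.toEquiv.subtypeEquiv fun w => ?_)).symm
  change G.dist w u < G.dist w v ↔ H.dist (e w) (e u) < H.dist (e w) (e v)
  rw [e.dist_eq_s10, e.dist_eq_s10]

open Classical in
lemma ABCGG_iso {G : SimpleGraph V} {H : SimpleGraph W} (e : G ≃g H) : ABCGG G = ABCGG H := by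
  unfold ABCGG
  congr 1
  refine Fintype.sum_equiv e.toEquiv _ _ fun u => Fintype.sum_equiv e.toEquiv _ _ fun v => ?_
  change _ = if H.Adj (e u) (e v) then Real.sqrt (((sideCount H (e u) (e v) : ℝ) +
    (sideCount H (e v) (e u) : ℝ) - 2) /
      ((sideCount H (e u) (e v) : ℝ) * (sideCount H (e v) (e u) : ℝ))) else 0
  rw [sideCount_iso, sideCount_iso]
  simp only [e.map_adj_iff]

lemma ABCGG_eq_of_dist [DecidableEq V] (G : SimpleGraph V) [DecidableRel G.Adj] (d : V → V → ℕ)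
    (hd : ∀ u v, G.dist u v = d u v) (N : V → V → ℕ)
    (hN : ∀ u v, G.Adj u v → (Finset.univ.filter fun w => d w u < d w v).card = N u v) :
    ABCGG G = (1 / 2) * ∑ u : V, ∑ v : V,
      if G.Adj u v then √(((N u v : ℝ) + N v u - 2) / (N u v * N v u)) else 0 := by
  have hside : ∀ u v, G.Adj u v → sideCount G u v = N u v := by
    intro u v h
    rw [← hN u v h, sideCount, Nat.card_eq_fintype_card, Fintype.card_subtype]
    simp only [hd]
  unfold ABCGG
  congr 1
  refine Finset.sum_congr rfl fun u _ => Finset.sum_congr rfl fun v _ => ?_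
  by_cases h : G.Adj u v
  · rw [if_pos h, if_pos h, hside u v h, hside v u h.symm]
  · rw [if_neg h, if_neg h]

end Index

section Concrete

/-- The graph whose edges are the listed pairs of distinct vertices. -/
def ofEdgeList {n : ℕ} (l : List (Fin n × Fin n)) : SimpleGraph (Fin n) :=
  SimpleGraph.fromRel fun i j => (i, j) ∈ l

instance {n : ℕ} (l : List (Fin n × Fin n)) : DecidableRel (ofEdgeList l).Adj :=
  inferInstanceAs (DecidableRel (SimpleGraph.fromRel _).Adj)

/-- The distance in a connected graph of diameter at most `3`. -/
def boundedDist {n : ℕ} (l : List (Fin n × Fin n)) (u v : Fin n) : ℕ :=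
  if u = v then 0 else if (ofEdgeList l).Adj u v then 1
  else if ∃ w, (ofEdgeList l).Adj u w ∧ (ofEdgeList l).Adj w v then 2 else 3

/-- Two triangles at `0`, with a vertex `5` attached to `1`. -/
abbrev sidePendentEdges : List (Fin 6 × Fin 6) :=
  [(0, 1), (1, 2), (2, 0), (0, 3), (3, 4), (4, 0), (1, 5)]

/-- Two triangles at `0`, with a vertex `5` attached to `0`. -/
abbrev centralPendentEdges : List (Fin 6 × Fin 6) :=
  [(0, 1), (1, 2), (2, 0), (0, 3), (3, 4), (4, 0), (0, 5)]

/-- A triangle and a quadrilateral at `0`. -/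
abbrev triangleSquareEdges : List (Fin 6 × Fin 6) :=
  [(0, 1), (1, 2), (2, 0), (0, 3), (3, 4), (4, 5), (5, 0)]

private lemma sqrt_four : √(4 : ℝ) = 2 := by
  rw [show (4 : ℝ) = 2 ^ 2 by norm_num, Real.sqrt_sq (by norm_num)]

private lemma inv_sqrt_two : (√(2 : ℝ))⁻¹ = √2 / 2 := by
  rw [inv_eq_one_div, div_eq_div_iff (by positivity) (by norm_num), one_mul]
  exact (Real.mul_self_sqrt (by norm_num)).symm

lemma ABCGG_sidePendent :
    ABCGG (ofEdgeList sidePendentEdges) = √3 + √2 + √(2 / 3) + √(4 / 5) := by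
  have h₃₂ : √3 / (√3 * √2) = √2 / 2 := by
    rw [div_mul_eq_div_div, div_self (by positivity), one_div, inv_sqrt_two]
  have h₂₃ : √3 / (√2 * √3) = √2 / 2 := by rw [mul_comm, h₃₂]
  rw [ABCGG_eq_of_dist _ (boundedDist sidePendentEdges)
    (dist_eq_of_forall _ (by decide) (by decide) (by decide))
    ![![0, 3, 3, 4, 4, 0], ![2, 0, 2, 0, 0, 5], ![1, 1, 0, 0, 0, 0], ![1, 0, 0, 0, 1, 0],
      ![1, 0, 0, 1, 0, 0], ![0, 1, 0, 0, 0, 0]] (by decide)]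
  simp +decide [Fin.sum_univ_six]
  norm_num [sqrt_four, h₃₂, h₂₃, inv_sqrt_two]
  ring

lemma ABCGG_centralPendent :
    ABCGG (ofEdgeList centralPendentEdges) = 2 * √3 + √(4 / 5) := by
  rw [ABCGG_eq_of_dist _ (boundedDist centralPendentEdges)
    (dist_eq_of_forall _ (by decide) (by decide) (by decide))
    ![![0, 4, 4, 4, 4, 5], ![1, 0, 1, 0, 0, 0], ![1, 1, 0, 0, 0, 0], ![1, 0, 0, 0, 1, 0],
      ![1, 0, 0, 1, 0, 0], ![1, 0, 0, 0, 0, 0]] (by decide)]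
  simp +decide [Fin.sum_univ_six]
  norm_num [sqrt_four]
  ring

lemma ABCGG_triangleSquare :
    ABCGG (ofEdgeList triangleSquareEdges) = √3 + 2 * √2 := by
  rw [ABCGG_eq_of_dist _ (boundedDist triangleSquareEdges)
    (dist_eq_of_forall _ (by decide) (by decide) (by decide))
    ![![0, 4, 4, 4, 0, 4], ![1, 0, 1, 0, 0, 0], ![1, 1, 0, 0, 0, 0], ![2, 0, 0, 0, 4, 0],
      ![0, 0, 0, 2, 0, 2], ![2, 0, 0, 0, 4, 0]] (by decide)]
  simp +decide [Fin.sum_univ_six]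
  norm_num [sqrt_four, inv_sqrt_two]
  ring_nf
  simp only [inv_sqrt_two]
  ring

lemma sidePendent_iso_S33 : Nonempty (ofEdgeList sidePendentEdges ≃g S33 1 0 0 0 0) := by
  let e : Fin 6 ≃ SVert 1 0 0 0 0 :=
    (finSumFinEquiv (m := 5) (n := 1)).symm.trans
      ((Equiv.refl _).sumCongr (Equiv.sumEmpty _ _).symm)
  suffices h : ∀ a b, (S33 1 0 0 0 0).Adj (e a) (e b) ↔ (ofEdgeList sidePendentEdges).Adj a b from
    ⟨⟨e, h _ _⟩⟩
  intro a b
  fin_cases a <;> fin_cases b <;> simp +decide [S33, e]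

end Concrete

section Structure

variable {V : Type*} {G : SimpleGraph V}

lemma SimpleGraph.Walk.IsCycle.exists_of_length_eq_three {w : V} {c : G.Walk w w}
    (hc : c.IsCycle) (hlen : c.length = 3) :
    ∃ a b, c.support = [w, a, b, w] ∧ [w, a, b].Nodup ∧ G.Adj w a ∧ G.Adj a b ∧ G.Adj b w := by
  have hnd := hc.support_nodup
  match c, hlen with
  | .cons (v := a) h₁ (.cons (v := b) h₂ (.cons (v := _) h₃ .nil)), _ =>
    refine ⟨a, b, rfl, ?_, h₁, h₂, h₃⟩
    simp at hnd ⊢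
    grind

lemma SimpleGraph.Walk.IsCycle.exists_of_length_eq_four {w : V} {c : G.Walk w w}
    (hc : c.IsCycle) (hlen : c.length = 4) :
    ∃ a b d, c.support = [w, a, b, d, w] ∧ [w, a, b, d].Nodup ∧
      G.Adj w a ∧ G.Adj a b ∧ G.Adj b d ∧ G.Adj d w := by
  have hnd := hc.support_nodup
  match c, hlen with
  | .cons (v := a) h₁ (.cons (v := b) h₂ (.cons (v := d) h₃ (.cons (v := _) h₄ .nil))), _ =>
    refine ⟨a, b, d, rfl, ?_, h₁, h₂, h₃, h₄⟩
    simp at hnd ⊢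
    grind

lemma exists_cycles_at_common_vertex [Fintype V] {n r t : ℕ} (h : InSnrt G n r t) :
    ∃ (w : V) (c₁ c₂ : G.Walk w w), c₁.IsCycle ∧ c₂.IsCycle ∧ c₁.length = r ∧ c₂.length = t ∧
      ∀ v ∈ c₁.support, v ∈ c₂.support → v = w := by
  classical
  obtain ⟨-, -, -, a, b, c₁, c₂, h₁, h₂, hr, ht, hcard⟩ := h
  obtain ⟨w, hw⟩ := Set.ncard_eq_one.1 hcard
  have hmem : ∀ v, v ∈ c₁.support ∧ v ∈ c₂.support ↔ v = w := fun v => Set.ext_iff.1 hw v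
  obtain ⟨hw₁, hw₂⟩ := (hmem w).2 rfl
  refine ⟨w, c₁.rotate w hw₁, c₂.rotate w hw₂, by simpa, by simpa, by simpa, by simpa, ?_⟩
  intro v hv₁ hv₂
  rw [Walk.mem_support_rotate_iff] at hv₁ hv₂
  exact (hmem v).1 ⟨hv₁, hv₂⟩

lemma length_add_length_le [Fintype V] {w : V} {c₁ c₂ : G.Walk w w} (h₁ : c₁.IsCycle)
    (h₂ : c₂.IsCycle) (h : ∀ v ∈ c₁.support, v ∈ c₂.support → v = w) :
    c₁.length + c₂.length ≤ Fintype.card V + 1 := by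
  classical
  have hcard : ∀ {c : G.Walk w w}, c.IsCycle → c.support.tail.toFinset.card = c.length := by
    intro c hc
    rw [List.toFinset_card_of_nodup hc.support_nodup]
    simp
  rw [← hcard h₁, ← hcard h₂, ← Finset.card_union_add_card_inter]
  refine add_le_add (Finset.card_le_univ _) (Finset.card_le_one.2 ?_)
  have hw : ∀ v ∈ c₁.support.tail.toFinset ∩ c₂.support.tail.toFinset, v = w := by
    intro v hv
    rw [Finset.mem_inter, List.mem_toFinset, List.mem_toFinset] at hv
    exact h v (List.mem_of_mem_tail hv.1) (List.mem_of_mem_tail hv.2)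
  intro x hx y hy
  rw [hw x hx, hw y hy]

lemma nonempty_iso_ofEdgeList [Fintype V] (hV : Fintype.card V = 6) (hG : G.edgeSet.ncard = 7)
    (l : List (Fin 6 × Fin 6)) (hl : (ofEdgeList l).edgeFinset.card = 7) (f : Fin 6 → V)
    (hf : Function.Injective f) (hadj : ∀ e ∈ l, G.Adj (f e.1) (f e.2)) :
    Nonempty (G ≃g ofEdgeList l) := by
  refine nonempty_iso_of_hom_bijective (H := ofEdgeList l) ⟨f, ?_⟩
    ((Fintype.bijective_iff_injective_and_card f).2 ⟨hf, by simp [hV]⟩) ?_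
  · rintro i j ⟨-, h | h⟩
    · exact hadj _ h
    · exact (hadj _ h).symm
  · rw [hG, Set.ncard_eq_toFinset_card', ← edgeFinset, hl]

lemma iso_sidePendent [Fintype V] (hV : Fintype.card V = 6) (hG : G.edgeSet.ncard = 7)
    {w a b c d e : V} (hnd : [w, a, b, c, d, e].Nodup) (hwa : G.Adj w a) (hab : G.Adj a b)
    (hbw : G.Adj b w) (hwc : G.Adj w c) (hcd : G.Adj c d) (hdw : G.Adj d w) (hae : G.Adj a e) :
    Nonempty (G ≃g ofEdgeList sidePendentEdges) :=
  nonempty_iso_ofEdgeList hV hG _ (by decide) [w, a, b, c, d, e].get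
    (List.nodup_iff_injective_get.1 hnd) (by simp [*])

lemma iso_of_bowtie [Fintype V] (hV : Fintype.card V = 6) (hconn : G.Connected)
    (hG : G.edgeSet.ncard = 7) {w a b c d : V} (hnd : [w, a, b, c, d].Nodup) (hwa : G.Adj w a)
    (hab : G.Adj a b) (hbw : G.Adj b w) (hwc : G.Adj w c) (hcd : G.Adj c d) (hdw : G.Adj d w) :
    Nonempty (G ≃g ofEdgeList sidePendentEdges) ∨
      Nonempty (G ≃g ofEdgeList centralPendentEdges) := by
  classical
  obtain ⟨e, he⟩ : ∃ e, e ∉ [w, a, b, c, d] := by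
    by_contra! h
    have hle := Finset.card_le_card (s := Finset.univ) (t := [w, a, b, c, d].toFinset)
      fun x _ => List.mem_toFinset.2 (h x)
    have := hle.trans (List.toFinset_card_le _)
    rw [Finset.card_univ, hV] at this
    simp at this
  have : Nontrivial V := ⟨w, a, hwa.ne⟩
  obtain ⟨x, hex⟩ := hconn.preconnected.exists_adj_of_nontrivial e
  have hxe := hex.symm
  have hnd' : [w, a, b, c, d, e].Nodup := by
    simp at hnd he ⊢
    grind
  by_cases hxl : x ∈ [w, a, b, c, d]
  · simp only [List.mem_cons, List.not_mem_nil, or_false] at hxl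
    rcases hxl with rfl | rfl | rfl | rfl | rfl
    · exact .inr (nonempty_iso_ofEdgeList hV hG _ (by decide) [x, a, b, c, d, e].get
        (List.nodup_iff_injective_get.1 hnd') (by simp [*]))
    · exact .inl (iso_sidePendent hV hG hnd' hwa hab hbw hwc hcd hdw hxe)
    · exact .inl (iso_sidePendent (b := a) (c := c) (d := d) hV hG (by grind) hbw.symm hab.symm
        hwa.symm hwc hcd hdw hxe)
    · exact .inl (iso_sidePendent (b := d) (c := a) (d := b) hV hG (by grind) hwc hcd hdw hwa hab
        hbw hxe)
    · exact .inl (iso_sidePendent (b := c) (c := a) (d := b) hV hG (by grind) hdw.symm hcd.symm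
        hwc.symm hwa hab hbw hxe)
  · exfalso
    have hnd'' : [w, a, b, c, d, e, x].Nodup := by
      have := hxe.ne
      simp at hnd' hxl ⊢
      grind
    have := hnd''.length_le_card
    simp [hV] at this

lemma iso_of_triangle_of_square [Fintype V] (hV : Fintype.card V = 6)
    (hG : G.edgeSet.ncard = 7) {w : V} {c₁ c₂ : G.Walk w w} (h₁ : c₁.IsCycle) (h₂ : c₂.IsCycle)
    (hl₁ : c₁.length = 3) (hl₂ : c₂.length = 4)
    (h : ∀ v ∈ c₁.support, v ∈ c₂.support → v = w) :
    Nonempty (G ≃g ofEdgeList triangleSquareEdges) := by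
  obtain ⟨a, b, hs₁, hnd₁, hwa, hab, hbw⟩ := h₁.exists_of_length_eq_three hl₁
  obtain ⟨c, d, e, hs₂, hnd₂, hwc, hcd, hde, hew⟩ := h₂.exists_of_length_eq_four hl₂
  simp only [hs₁, hs₂] at h
  have hnd : [w, a, b, c, d, e].Nodup := by
    simp at hnd₁ hnd₂ h ⊢
    grind
  exact nonempty_iso_ofEdgeList hV hG _ (by decide) [w, a, b, c, d, e].get
    (List.nodup_iff_injective_get.1 hnd) (by simp [*])

lemma iso_of_inSnrt_six [Fintype V] {r t : ℕ} (hr : 3 ≤ r) (ht : 3 ≤ t) (hG : InSnrt G 6 r t) :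
    Nonempty (G ≃g ofEdgeList sidePendentEdges) ∨
      Nonempty (G ≃g ofEdgeList centralPendentEdges) ∨
        Nonempty (G ≃g ofEdgeList triangleSquareEdges) := by
  obtain ⟨w, c₁, c₂, h₁, h₂, rfl, rfl, h⟩ := exists_cycles_at_common_vertex hG
  obtain ⟨hV, hconn, hE, -⟩ := hG
  have hle := length_add_length_le h₁ h₂ h
  rw [hV] at hle
  obtain ⟨hl₁, hl₂⟩ | ⟨hl₁, hl₂⟩ | ⟨hl₁, hl₂⟩ : (c₁.length = 3 ∧ c₂.length = 3) ∨
      (c₁.length = 3 ∧ c₂.length = 4) ∨ (c₁.length = 4 ∧ c₂.length = 3) := by omega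
  · obtain ⟨a, b, hs₁, hnd₁, hwa, hab, hbw⟩ := h₁.exists_of_length_eq_three hl₁
    obtain ⟨c, d, hs₂, hnd₂, hwc, hcd, hdw⟩ := h₂.exists_of_length_eq_three hl₂
    simp only [hs₁, hs₂] at h
    have hnd : [w, a, b, c, d].Nodup := by
      simp at hnd₁ hnd₂ h ⊢
      grind
    exact (iso_of_bowtie hV hconn hE hnd hwa hab hbw hwc hcd hdw).imp id .inl
  · exact .inr (.inr (iso_of_triangle_of_square hV hE h₁ h₂ hl₁ hl₂ h))
  · exact .inr (.inr (iso_of_triangle_of_square hV hE h₂ h₁ hl₂ hl₁ fun v hv hv' => h v hv' hv))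

end Structure

theorem stmt10 {V : Type*} [Fintype V] (G : SimpleGraph V) (r t : ℕ)
    (hr : 3 ≤ r) (ht : 3 ≤ t) (hG : InSnrt G 6 r t) :
    ABCGG G ≤ Real.sqrt 3 + Real.sqrt 2 + Real.sqrt (2 / 3) + Real.sqrt (4 / 5) ∧
    (ABCGG G = Real.sqrt 3 + Real.sqrt 2 + Real.sqrt (2 / 3) + Real.sqrt (4 / 5) ↔
      Nonempty (G ≃g S33 1 0 0 0 0)) := by
  obtain ⟨i⟩ := sidePendent_iso_S33
  have h₃ : √(3 : ℝ) < 1.733 := (Real.sqrt_lt' (by norm_num)).2 (by norm_num)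
  have h₂ : 1.414 < √(2 : ℝ) := Real.lt_sqrt_of_sq_lt (by norm_num)
  have h₂' : √(2 : ℝ) < 1.415 := (Real.sqrt_lt' (by norm_num)).2 (by norm_num)
  have h₂₃ : 0.8 < √(2 / 3 : ℝ) := Real.lt_sqrt_of_sq_lt (by norm_num)
  have h₄₅ : 0.8 < √(4 / 5 : ℝ) := Real.lt_sqrt_of_sq_lt (by norm_num)
  have hcases : Nonempty (G ≃g S33 1 0 0 0 0) ∨
      ABCGG G < √3 + √2 + √(2 / 3) + √(4 / 5) := by
    obtain ⟨⟨e⟩⟩ | ⟨⟨e⟩⟩ | ⟨⟨e⟩⟩ := iso_of_inSnrt_six hr ht hG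
    · exact .inl ⟨e.trans i⟩
    · rw [ABCGG_iso e, ABCGG_centralPendent]
      right
      linarith
    · rw [ABCGG_iso e, ABCGG_triangleSquare]
      right
      linarith
  have heq : ∀ _ : G ≃g S33 1 0 0 0 0, ABCGG G = √3 + √2 + √(2 / 3) + √(4 / 5) :=
    fun e => by rw [ABCGG_iso (e.trans i.symm), ABCGG_sidePendent]
  refine ⟨?_, fun h => hcases.resolve_right h.not_lt, fun ⟨e⟩ => heq e⟩
  rcases hcases with ⟨⟨e⟩⟩ | h
  · exact (heq e).le
  · exact h.le
end

section
/- Let G ∈ S_n^{r,t} be a connected bicyclic graph of order n = 8 whose two cycles have lengths r and t and share exactly one common vertex. Then ABC_GG(G) ≤ sqrt(2) + sqrt(2/3) + sqrt(3/4) + sqrt(4/5) + sqrt(5/12) + 3·sqrt(6/7), with equality if and only if G = S_8^{3,3}(2, 1, 0). -/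
namespace GraovacGhorbani

open SimpleGraph

section General

variable {V W : Type*}

lemma dist_iso {G : SimpleGraph V} {H : SimpleGraph W} (e : G ≃g H) (u v : V) :
    H.dist (e u) (e v) = G.dist u v := by
  rw [dist_eq_sInf, dist_eq_sInf]
  congr 1
  ext k
  constructor
  · rintro ⟨p, rfl⟩
    exact ⟨(p.map e.symm.toHom).copy (by simp) (by simp), by simp⟩
  · rintro ⟨p, rfl⟩
    exact ⟨p.map e.toHom, by simp⟩

lemma sideCount_iso [Fintype V] [Fintype W] {G : SimpleGraph V} {H : SimpleGraph W}
    (e : G ≃g H) (u v : V) : sideCount H (e u) (e v) = sideCount G u v := by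
  refine (Nat.card_congr (e.toEquiv.subtypeEquiv fun w => ?_)).symm
  change _ ↔ H.dist (e w) (e u) < H.dist (e w) (e v)
  rw [dist_iso, dist_iso]

lemma ABCGG_iso [Fintype V] [Fintype W] {G : SimpleGraph V} {H : SimpleGraph W}
    (e : G ≃g H) : ABCGG G = ABCGG H := by
  classical
  unfold ABCGG
  congr 1
  refine Fintype.sum_equiv e.toEquiv _ _ fun u => Fintype.sum_equiv e.toEquiv _ _ fun v => ?_
  change _ = if H.Adj (e u) (e v) then √(((sideCount H (e u) (e v) : ℝ) +
    (sideCount H (e v) (e u) : ℝ) - 2) / ((sideCount H (e u) (e v) : ℝ) *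
    (sideCount H (e v) (e u) : ℝ))) else 0
  simp only [e.map_adj_iff, sideCount_iso]

/-- A function which is `1`-Lipschitz along edges and, away from the source, decreases by one
towards some neighbour is the graph distance. -/
lemma dist_eq_of_local {G : SimpleGraph V} {d : V → V → ℕ} (h0 : ∀ u, d u u = 0)
    (hlip : ∀ u v w, G.Adj v w → d u w ≤ d u v + 1)
    (hpred : ∀ u v, u ≠ v → ∃ w, G.Adj w v ∧ d u w + 1 = d u v) (u v : V) :
    G.dist u v = d u v := by
  have hle : ∀ (a b : V) (p : G.Walk a b), d u b ≤ d u a + p.length := by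
    intro a b p
    induction p with
    | nil => simp
    | cons h p ih =>
      have := hlip u _ _ h
      simp only [Walk.length_cons]
      omega
  have hex : ∀ n v, d u v = n → ∃ p : G.Walk u v, p.length = n := by
    intro n
    induction n with
    | zero =>
      intro v hv
      by_cases huv : u = v
      · subst huv
        exact ⟨Walk.nil, rfl⟩
      · obtain ⟨w, -, hw⟩ := hpred u v huv
        omega
    | succ n ih =>
      intro v hv
      have huv : u ≠ v := by
        rintro rfl
        rw [h0] at hv
        omega
      obtain ⟨w, hwv, hw⟩ := hpred u v huv
      obtain ⟨p, hp⟩ := ih w (by omega)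
      exact ⟨p.concat hwv, by simp [hp]⟩
  obtain ⟨p, hp⟩ := hex _ v rfl
  refine le_antisymm (hp ▸ dist_le p) ?_
  obtain ⟨q, hq⟩ := Reachable.exists_walk_length_eq_dist ⟨p⟩
  have := hle u v q
  rw [h0] at this
  omega

/-- `f` labels `k` distinct vertices of `G` by the numbers below `k`, in such a way that all
pairs in `L` become edges of `G`. -/
def IsLabelling (G : SimpleGraph V) (k : ℕ) (L : List (ℕ × ℕ)) (f : ℕ → V) : Prop :=
  Set.InjOn f (Set.Iio k) ∧ ∀ p ∈ L, G.Adj (f p.1) (f p.2)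

lemma IsLabelling.le_card [Fintype V] {G : SimpleGraph V} {k : ℕ} {L : List (ℕ × ℕ)} {f : ℕ → V}
    (h : IsLabelling G k L f) : k ≤ Fintype.card V := by
  have hinj : Function.Injective fun i : Fin k => f i := fun i j hij =>
    Fin.ext (h.1 i.2 j.2 hij)
  simpa using Fintype.card_le_of_injective _ hinj

end General

/-- The graph on `Fin 8` with the given list of edges. -/
def listGraph (L : List (ℕ × ℕ)) : SimpleGraph (Fin 8) :=
  SimpleGraph.fromRel fun i j => (i.val, j.val) ∈ L

/-- Membership of the unordered pair `{i, j}` in the list `L`. -/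
def adjacent (L : List (ℕ × ℕ)) (i j : ℕ) : Bool :=
  L.any fun p => (Nat.beq p.1 i && Nat.beq p.2 j) || (Nat.beq p.1 j && Nat.beq p.2 i)

/-- The sum of the values of `f` at the numbers below eight. -/
def sumEight (f : ℕ → ℕ) : ℕ := f 0 + f 1 + f 2 + f 3 + f 4 + f 5 + f 6 + f 7

/-- The number of `w < 8` which are closer to `u` than to `v` with respect to `d`. -/
def closerCount (d : ℕ → ℕ → ℕ) (u v : ℕ) : ℕ :=
  sumEight fun w => bif Nat.blt (d w u) (d w v) then 1 else 0

/-- An integer upper bound for `1000 * sqrt ((a + b - 2) / (a * b))`. -/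
def weightBound (a b : ℕ) : ℕ := Nat.sqrt (1000000 * (a + b - 2) / (a * b)) + 1

/-- A test for `d` being the distance function of `listGraph L`, this graph being loopless. -/
def isDist (L : List (ℕ × ℕ)) (d : ℕ → ℕ → ℕ) : Bool :=
  (List.range 8).all fun u => Nat.beq (d u u) 0 && !adjacent L u u &&
    (L.all fun p => Nat.ble (d u p.1) (d u p.2 + 1) && Nat.ble (d u p.2) (d u p.1 + 1)) &&
    (List.range 8).all fun v => Nat.beq u v ||
      (List.range 8).any fun w => adjacent L w v && Nat.beq (d u w + 1) (d u v)

lemma sumEight_eq (f : ℕ → ℕ) : sumEight f = ∑ i : Fin 8, f i := by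
  simp [sumEight, Fin.sum_univ_eight]

lemma adjacent_iff {L : List (ℕ × ℕ)} {i j : ℕ} :
    adjacent L i j = true ↔ (i, j) ∈ L ∨ (j, i) ∈ L := by
  simp only [adjacent, List.any_eq_true, Bool.or_eq_true, Bool.and_eq_true, Nat.beq_eq]
  constructor
  · rintro ⟨⟨a, b⟩, h, ⟨rfl, rfl⟩ | ⟨rfl, rfl⟩⟩
    exacts [Or.inl h, Or.inr h]
  · rintro (h | h)
    exacts [⟨_, h, by simp⟩, ⟨_, h, by simp⟩]

lemma listGraph_adj {L : List (ℕ × ℕ)} {i j : Fin 8} :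
    (listGraph L).Adj i j ↔ i ≠ j ∧ adjacent L i j = true := by
  rw [adjacent_iff, listGraph, fromRel_adj]

/-- `listGraph L` has exactly the edges in `L`, and `d` is its distance function. -/
structure IsDist (L : List (ℕ × ℕ)) (d : ℕ → ℕ → ℕ) : Prop where
  adj_iff : ∀ i j : Fin 8, (listGraph L).Adj i j ↔ adjacent L i j = true
  dist_eq : ∀ i j : Fin 8, (listGraph L).dist i j = d i j

lemma isDist_spec {L : List (ℕ × ℕ)} {d : ℕ → ℕ → ℕ} (h : isDist L d = true) : IsDist L d := by
  simp only [isDist, List.all_eq_true, List.any_eq_true, List.mem_range, Bool.and_eq_true,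
    Bool.or_eq_true, Nat.beq_eq, Nat.ble_eq, Bool.not_eq_true'] at h
  have hadj (i j : Fin 8) : (listGraph L).Adj i j ↔ adjacent L i j = true := by
    rw [listGraph_adj, and_iff_right_iff_imp]
    rintro hij rfl
    simp [(h i i.2).1.1.2] at hij
  refine ⟨hadj, dist_eq_of_local (d := fun i j : Fin 8 => d i j) (fun u => (h u u.2).1.1.1) ?_ ?_⟩
  · intro u v w hvw
    rw [hadj, adjacent_iff] at hvw
    rcases hvw with hvw | hvw
    exacts [((h u u.2).1.2 _ hvw).2, ((h u u.2).1.2 _ hvw).1]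
  · intro u v huv
    obtain huv' | ⟨w, hw, hwv, hd⟩ := (h u u.2).2 v v.2
    · exact absurd (Fin.ext huv') huv
    · exact ⟨⟨w, hw⟩, (hadj _ _).2 hwv, hd⟩

lemma IsDist.sideCount_eq {L : List (ℕ × ℕ)} {d : ℕ → ℕ → ℕ} (h : IsDist L d) (u v : Fin 8) :
    sideCount (listGraph L) u v = closerCount d u v := by
  rw [sideCount, closerCount, sumEight_eq, Nat.card_eq_fintype_card, Fintype.card_subtype,
    Finset.card_filter]
  simp [h.dist_eq, Bool.cond_eq_ite, Nat.blt_eq]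

lemma IsDist.ABCGG_eq {L : List (ℕ × ℕ)} {d : ℕ → ℕ → ℕ} (h : IsDist L d) :
    ABCGG (listGraph L) = 1 / 2 * ∑ u : Fin 8, ∑ v : Fin 8, if adjacent L u v = true then
      √(((closerCount d u v : ℝ) + (closerCount d v u : ℝ) - 2) /
        ((closerCount d u v : ℝ) * (closerCount d v u : ℝ))) else 0 := by
  simp only [ABCGG, h.adj_iff, h.sideCount_eq]

lemma sqrt_le_weightBound (a b : ℕ) :
    √(((a : ℝ) + b - 2) / ((a : ℝ) * b)) ≤ (weightBound a b : ℝ) / 1000 := by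
  rcases Nat.eq_zero_or_pos (a * b) with hab | hab
  · have : (a : ℝ) * b = 0 := by exact_mod_cast hab
    rw [this, div_zero, Real.sqrt_zero]
    positivity
  apply Real.sqrt_le_iff.2 ⟨by positivity, ?_⟩
  have hlt : 1000000 * (a + b - 2) / (a * b) < weightBound a b * weightBound a b :=
    Nat.lt_succ_sqrt _
  rw [Nat.div_lt_iff_lt_mul hab] at hlt
  have hlt' : (1000000 : ℝ) * ((a + b - 2 : ℕ) : ℝ) <
      (weightBound a b : ℝ) * weightBound a b * (a * b) := by exact_mod_cast hlt
  have hsub : (a : ℝ) + b - 2 ≤ ((a + b - 2 : ℕ) : ℝ) := by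
    have : a + b ≤ (a + b - 2) + 2 := by omega
    have : (a : ℝ) + b ≤ ((a + b - 2 : ℕ) : ℝ) + 2 := by exact_mod_cast this
    linarith
  have hpos : (0 : ℝ) < (a : ℝ) * b := by exact_mod_cast hab
  rw [div_le_iff₀ hpos]
  nlinarith

/-- Twice the sum of the weight bounds over all edges. -/
def totalBound (L : List (ℕ × ℕ)) (d : ℕ → ℕ → ℕ) : ℕ :=
  sumEight fun u => sumEight fun v =>
    bif adjacent L u v then weightBound (closerCount d u v) (closerCount d v u) else 0

lemma IsDist.ABCGG_le {L : List (ℕ × ℕ)} {d : ℕ → ℕ → ℕ} (h : IsDist L d) :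
    ABCGG (listGraph L) ≤ (totalBound L d : ℝ) / 2000 := by
  have key : ∑ u : Fin 8, ∑ v : Fin 8, (if adjacent L u v = true then
      √(((closerCount d u v : ℝ) + (closerCount d v u : ℝ) - 2) /
        ((closerCount d u v : ℝ) * (closerCount d v u : ℝ))) else 0) ≤
      (totalBound L d : ℝ) / 1000 := by
    simp only [totalBound, sumEight_eq, Nat.cast_sum, Finset.sum_div]
    refine Finset.sum_le_sum fun u _ => Finset.sum_le_sum fun v _ => ?_
    cases adjacent L u v
    · simp
    · simpa using sqrt_le_weightBound _ _
  rw [h.ABCGG_eq]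
  linarith

/-- Twice the number of edges in the list. -/
def totalDegree (L : List (ℕ × ℕ)) : ℕ :=
  sumEight fun u => sumEight fun v => bif adjacent L u v then 1 else 0

lemma IsDist.ncard_edgeSet {L : List (ℕ × ℕ)} {d : ℕ → ℕ → ℕ} (h : IsDist L d)
    (hL : totalDegree L = 18) : (listGraph L).edgeSet.ncard = 9 := by
  classical
  have hsum := (listGraph L).sum_degrees_eq_twice_card_edges
  have hdeg : ∑ v, (listGraph L).degree v = totalDegree L := by
    simp only [totalDegree, sumEight_eq]
    refine Finset.sum_congr rfl fun u _ => ?_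
    rw [← card_neighborFinset_eq_degree, neighborFinset_eq_filter, Finset.card_filter]
    simp [h.adj_iff, Bool.cond_eq_ite]
  rw [← coe_edgeFinset, Set.ncard_coe_finset]
  omega

lemma IsDist.nonempty_iso {V : Type*} [Fintype V] {G : SimpleGraph V} {L : List (ℕ × ℕ)}
    {d : ℕ → ℕ → ℕ} (h : IsDist L d) (hL : totalDegree L = 18) (hV : Fintype.card V = 8)
    (hE : G.edgeSet.ncard = 9) {f : ℕ → V} (hf : IsLabelling G 8 L f) :
    Nonempty (listGraph L ≃g G) := by
  classical
  have hinj : Function.Injective fun i : Fin 8 => f i := fun i j hij =>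
    Fin.ext (hf.1 i.2 j.2 hij)
  have hbij := (Fintype.bijective_iff_injective_and_card _).2 ⟨hinj, by simp [hV]⟩
  let e : Fin 8 ≃ V := Equiv.ofBijective _ hbij
  have hle : listGraph L ≤ G.comap e := by
    intro i j hij
    rw [h.adj_iff, adjacent_iff] at hij
    rcases hij with hij | hij
    exacts [hf.2 _ hij, (hf.2 _ hij).symm]
  have hcard : (G.comap e).edgeFinset.card = G.edgeFinset.card :=
    (SimpleGraph.Iso.comap e G).card_edgeFinset_eq
  have h9 := h.ncard_edgeSet hL
  rw [← coe_edgeFinset, Set.ncard_coe_finset] at h9 hE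
  have heq : (listGraph L).edgeFinset = (G.comap e).edgeFinset :=
    Finset.eq_of_subset_of_card_le (edgeFinset_subset_edgeFinset.2 hle) (by omega)
  rw [edgeFinset_inj.1 heq]
  exact ⟨SimpleGraph.Iso.comap e G⟩

section Family

/-- The distance of the vertices `i` and `j` on a cycle of length `r`. -/
def cycleDist (r i j : ℕ) : ℕ :=
  bif Nat.ble ((i - j) + (j - i)) (r - ((i - j) + (j - i))) then (i - j) + (j - i)
  else r - ((i - j) + (j - i))

/-- The distance in the union of the cycles on `0, 1, …, r - 1` and `0, r, …, r + t - 2`. -/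
def cyclesDist (r t i j : ℕ) : ℕ :=
  cycleDist r (bif Nat.blt i r then i else 0) (bif Nat.blt j r then j else 0) +
    cycleDist t (i + 1 - r) (j + 1 - r)

/-- The position of the `j`-th vertex of the second cycle. -/
def secondVertex (r j : ℕ) : ℕ := bif Nat.beq j 0 then 0 else r + j - 1

lemma secondVertex_zero (r : ℕ) : secondVertex r 0 = 0 := rfl

lemma secondVertex_of_pos {r j : ℕ} (hj : 0 < j) : secondVertex r j = r + j - 1 := by
  obtain ⟨j, rfl⟩ := Nat.exists_eq_add_one.2 hj
  rfl

/-- The edges of the cycles on `0, 1, …, r - 1` and `0, r, …, r + t - 2`. -/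
def cyclesEdges (r t : ℕ) : List (ℕ × ℕ) :=
  (List.range r).map (fun i => (i, (i + 1) % r)) ++
    (List.range t).map fun j => (secondVertex r j, secondVertex r ((j + 1) % t))

/-- The distance after attaching the pendent edges in `Q`, last one first. -/
def pendentDist (d : ℕ → ℕ → ℕ) : List (ℕ × ℕ) → ℕ → ℕ → ℕ
  | [], i, j => d i j
  | (p, k) :: Q, i, j =>
    bif Nat.beq i k then (bif Nat.beq j k then 0 else pendentDist d Q p j + 1)
    else (bif Nat.beq j k then pendentDist d Q i p + 1 else pendentDist d Q i j)

/-- All ways to attach successively the vertices `k, …, k + m - 1` to smaller ones. -/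
def extensions : ℕ → ℕ → List (ℕ × ℕ) → List (List (ℕ × ℕ))
  | 0, _, Q => [Q]
  | m + 1, k, Q => (List.range k).flatMap fun i => extensions m (k + 1) ((i, k) :: Q)

/-- The edges of `S_8^{3,3}(2, 1, 0)`. -/
def extremalEdges : List (ℕ × ℕ) := [(3, 7), (1, 6), (1, 5)] ++ cyclesEdges 3 3

/-- Candidates for renumberings turning a graph into the extremal one. -/
def renumberings : List (List ℕ) :=
  [[0, 1, 2, 3, 4], [0, 2, 1, 3, 4], [0, 1, 2, 4, 3], [0, 2, 1, 4, 3],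
    [0, 3, 4, 1, 2], [0, 3, 4, 2, 1], [0, 4, 3, 1, 2], [0, 4, 3, 2, 1]].flatMap fun l =>
  [[5, 6, 7], [5, 7, 6], [6, 7, 5]].map fun l' => l ++ l'

/-- The test applied to every bicyclic graph in the family. -/
def admissible (L : List (ℕ × ℕ)) (d : ℕ → ℕ → ℕ) : Bool :=
  isDist L d && Nat.beq (totalDegree L) 18 && (Nat.blt (totalBound L d) 14820 ||
    renumberings.any fun s => extremalEdges.all fun p => adjacent L (s.getD p.1 0) (s.getD p.2 0))

/-- The test for all graphs whose cycles have lengths `r` and `t`. -/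
def familyAdmissible (r t : ℕ) : Bool :=
  (extensions (9 - r - t) (r + t - 1) []).all fun Q =>
    admissible (Q ++ cyclesEdges r t) (pendentDist (cyclesDist r t) Q)

lemma familyAdmissible_of_le {r t : ℕ} (hr : 3 ≤ r) (hrt : r ≤ t) (h : r + t ≤ 9) :
    familyAdmissible r t = true := by
  have hall : familyAdmissible 3 3 = true ∧ familyAdmissible 3 4 = true ∧
      familyAdmissible 3 5 = true ∧ familyAdmissible 3 6 = true ∧
      familyAdmissible 4 4 = true ∧ familyAdmissible 4 5 = true := by
    decide +kernel
  obtain ⟨h33, h34, h35, h36, h44, h45⟩ := hall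
  obtain ⟨rfl, rfl⟩ | ⟨rfl, rfl⟩ | ⟨rfl, rfl⟩ | ⟨rfl, rfl⟩ | ⟨rfl, rfl⟩ | ⟨rfl, rfl⟩ :
      r = 3 ∧ t = 3 ∨ r = 3 ∧ t = 4 ∨ r = 3 ∧ t = 5 ∨ r = 3 ∧ t = 6 ∨ r = 4 ∧ t = 4 ∨
        r = 4 ∧ t = 5 := by omega
  exacts [h33, h34, h35, h36, h44, h45]

end Family

section Structure

variable {V : Type*} {G : SimpleGraph V}

lemma IsLabelling.exists_extend [Fintype V] {k : ℕ} {L : List (ℕ × ℕ)} {f : ℕ → V}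
    (hf : IsLabelling G k L f) (hL : ∀ p ∈ L, p.1 < k ∧ p.2 < k) (hG : G.Connected) (hk0 : 0 < k)
    (hk : k < Fintype.card V) :
    ∃ i < k, ∃ f', IsLabelling G (k + 1) ((i, k) :: L) f' := by
  classical
  have hnot : ∃ v, v ∉ f '' Set.Iio k := by
    by_contra! h
    have hcard : (Finset.univ : Finset V).card ≤ ((Finset.range k).image f).card := by
      refine Finset.card_le_card fun v _ => ?_
      obtain ⟨i, hi, rfl⟩ := h v
      exact Finset.mem_image_of_mem _ (Finset.mem_range.2 hi)
    have := Finset.card_image_le (s := Finset.range k) (f := f)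
    rw [Finset.card_range] at this
    rw [Finset.card_univ] at hcard
    omega
  obtain ⟨v, hv⟩ := hnot
  obtain ⟨p⟩ := hG.preconnected (f 0) v
  obtain ⟨⟨⟨x, y⟩, hxy⟩, -, hx, hy⟩ := p.exists_boundary_dart (f '' Set.Iio k)
    ⟨0, hk0, rfl⟩ hv
  obtain ⟨i, hi, rfl⟩ := hx
  simp only at hy hxy
  have hi' : i < k := hi
  refine ⟨i, hi', Function.update f k y, ?_, ?_⟩
  · intro a ha b hb hab
    have ha' : a < k + 1 := ha
    have hb' : b < k + 1 := hb
    rcases eq_or_ne a k with rfl | hak <;> rcases eq_or_ne b a with rfl | hbk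
    · rfl
    · rw [Function.update_self, Function.update_of_ne hbk] at hab
      exact absurd ⟨b, show b < a by omega, hab.symm⟩ hy
    · rfl
    · rw [Function.update_of_ne hak] at hab
      rcases eq_or_ne b k with rfl | hbk'
      · rw [Function.update_self] at hab
        exact absurd ⟨a, show a < b by omega, hab⟩ hy
      · rw [Function.update_of_ne hbk'] at hab
        exact hf.1 (show a < k by omega) (show b < k by omega) hab
  · intro q hq
    rcases List.mem_cons.1 hq with rfl | hq
    · simpa [Function.update_of_ne hi'.ne] using hxy
    · rw [Function.update_of_ne (hL q hq).1.ne, Function.update_of_ne (hL q hq).2.ne]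
      exact hf.2 q hq

lemma IsLabelling.exists_mem_extensions [Fintype V] (hG : G.Connected)
    (hV : Fintype.card V = 8) {B : List (ℕ × ℕ)} (m : ℕ) :
    ∀ (k : ℕ) (Q : List (ℕ × ℕ)) (f : ℕ → V), IsLabelling G k (Q ++ B) f →
      (∀ p ∈ Q ++ B, p.1 < k ∧ p.2 < k) → 0 < k → k + m = 8 →
      ∃ Q' ∈ extensions m k Q, ∃ f', IsLabelling G 8 (Q' ++ B) f' := by
  induction m with
  | zero =>
    rintro k Q f hf - - rfl
    exact ⟨Q, by simp [extensions], f, hf⟩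
  | succ m ih =>
    intro k Q f hf hL hk0 hk
    obtain ⟨i, hi, f', hf'⟩ := hf.exists_extend hL hG hk0 (by omega)
    obtain ⟨Q', hQ', h⟩ := ih (k + 1) ((i, k) :: Q) f' hf' (by
      intro p hp
      rcases List.mem_cons.1 hp with rfl | hp
      · exact ⟨by simp only; omega, by simp⟩
      · exact ⟨(hL p hp).1.trans k.lt_succ_self, (hL p hp).2.trans k.lt_succ_self⟩) k.succ_pos
      (by omega)
    exact ⟨Q', List.mem_flatMap.2 ⟨i, List.mem_range.2 hi, hQ'⟩, h⟩

lemma cyclesEdges_lt {r t : ℕ} (hr : 0 < r) (ht : 0 < t) :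
    ∀ p ∈ cyclesEdges r t, p.1 < r + t - 1 ∧ p.2 < r + t - 1 := by
  have hsec (j : ℕ) (hj : j < t) : secondVertex r j < r + t - 1 := by
    rcases Nat.eq_zero_or_pos j with rfl | hj0
    · rw [secondVertex_zero]
      omega
    · rw [secondVertex_of_pos hj0]
      omega
  intro p hp
  simp only [cyclesEdges, List.mem_append, List.mem_map, List.mem_range] at hp
  obtain ⟨i, hi, rfl⟩ | ⟨j, hj, rfl⟩ := hp
  · have := Nat.mod_lt (i + 1) hr
    simp only
    omega
  · exact ⟨hsec j hj, hsec _ (Nat.mod_lt _ ht)⟩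

lemma getVert_mod {a : V} {c : G.Walk a a} (i : ℕ) (hi : i < c.length) :
    c.getVert ((i + 1) % c.length) = c.getVert (i + 1) := by
  rcases (show i + 1 ≤ c.length from hi).lt_or_eq with h | h
  · rw [Nat.mod_eq_of_lt h]
  · rw [h, Nat.mod_self, Walk.getVert_zero, Walk.getVert_length]

lemma isLabelling_cycles {a : V} {c₁ c₂ : G.Walk a a} (h₁ : c₁.IsCycle) (h₂ : c₂.IsCycle)
    (h : ∀ v, v ∈ c₁.support → v ∈ c₂.support → v = a) :
    ∃ f, IsLabelling G (c₁.length + c₂.length - 1) (cyclesEdges c₁.length c₂.length) f := by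
  have hl₁ := h₁.three_le_length
  have hl₂ := h₂.three_le_length
  have inj₁ (i j : ℕ) (hi : i < c₁.length) (hj : j < c₁.length)
      (hij : c₁.getVert i = c₁.getVert j) : i = j :=
    h₁.getVert_injOn' (show i ≤ c₁.length - 1 by omega) (show j ≤ c₁.length - 1 by omega) hij
  have inj₂ (i j : ℕ) (hi : i < c₂.length) (hj : j < c₂.length)
      (hij : c₂.getVert i = c₂.getVert j) : i = j :=
    h₂.getVert_injOn' (show i ≤ c₂.length - 1 by omega) (show j ≤ c₂.length - 1 by omega) hij
  have cross (i j : ℕ) (hj : j < c₂.length) (hij : c₁.getVert i = c₂.getVert j) : j = 0 := by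
    have := h _ (c₁.getVert_mem_support i) (hij ▸ c₂.getVert_mem_support j)
    exact inj₂ j 0 hj (by omega) (by rw [← hij, this, Walk.getVert_zero])
  set f : ℕ → V := fun i => if i < c₁.length then c₁.getVert i
    else c₂.getVert (i + 1 - c₁.length) with hf
  have hf₁ (i : ℕ) (hi : i < c₁.length) : f i = c₁.getVert i := if_pos hi
  have hf₂ (j : ℕ) : f (secondVertex c₁.length j) = c₂.getVert j := by
    rcases Nat.eq_zero_or_pos j with rfl | hj0
    · rw [secondVertex_zero, hf₁ 0 (by omega), Walk.getVert_zero, Walk.getVert_zero]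
    · rw [secondVertex_of_pos hj0]
      simp only [hf]
      rw [if_neg (by omega)]
      congr 1
      omega
  refine ⟨f, ?_, ?_⟩
  · intro i hi j hj hij
    have hi' : i < c₁.length + c₂.length - 1 := hi
    have hj' : j < c₁.length + c₂.length - 1 := hj
    simp only [hf] at hij
    split_ifs at hij with h₃ h₄ h₄
    · exact inj₁ i j h₃ h₄ hij
    · have := cross _ _ (by omega) hij
      omega
    · have := cross _ _ (by omega) hij.symm
      omega
    · have := inj₂ _ _ (by omega) (by omega) hij
      omega
  · intro p hp
    simp only [cyclesEdges, List.mem_append, List.mem_map, List.mem_range] at hp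
    obtain ⟨i, hi, rfl⟩ | ⟨j, hj, rfl⟩ := hp
    · simp only
      rw [hf₁ i hi, hf₁ _ (Nat.mod_lt _ (by omega)), getVert_mod i hi]
      exact c₁.adj_getVert_succ hi
    · simp only
      rw [hf₂, hf₂, getVert_mod j hj]
      exact c₂.adj_getVert_succ hj

lemma InSnrt.symm [Fintype V] {n r t : ℕ} (h : InSnrt G n r t) : InSnrt G n t r := by
  obtain ⟨hV, hG, hE, a, b, c₁, c₂, h₁, h₂, hl₁, hl₂, hi⟩ := h
  exact ⟨hV, hG, hE, b, a, c₂, c₁, h₂, h₁, hl₂, hl₁, by rwa [Set.inter_comm]⟩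

lemma InSnrt.exists_isLabelling_cycles [Fintype V] {n r t : ℕ} (h : InSnrt G n r t) :
    ∃ f, IsLabelling G (r + t - 1) (cyclesEdges r t) f := by
  classical
  obtain ⟨-, -, -, a, b, c₁, c₂, h₁, h₂, rfl, rfl, hi⟩ := h
  obtain ⟨w, hw⟩ := Set.ncard_eq_one.1 hi
  obtain ⟨hw₁, hw₂⟩ : w ∈ c₁.support ∧ w ∈ c₂.support := by
    have : w ∈ ({w} : Set V) := rfl
    rwa [← hw] at this
  have key := isLabelling_cycles (h₁.rotate hw₁) (h₂.rotate hw₂) (fun v hv₁ hv₂ => by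
    rw [Walk.mem_support_rotate_iff] at hv₁ hv₂
    have : v ∈ ({v | v ∈ c₁.support} ∩ {v | v ∈ c₂.support} : Set V) := ⟨hv₁, hv₂⟩
    rwa [hw] at this)
  rwa [Walk.length_rotate, Walk.length_rotate] at key

lemma IsLabelling.renumber {L L' : List (ℕ × ℕ)} {f : ℕ → V} (hf : IsLabelling G 8 L f)
    {s : List ℕ} (hs : s.Nodup) (hlen : s.length = 8) (hlt : ∀ x ∈ s, x < 8)
    (h : ∀ p ∈ L', adjacent L (s.getD p.1 0) (s.getD p.2 0) = true) :
    IsLabelling G 8 L' fun i => f (s.getD i 0) := by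
  refine ⟨?_, fun p hp => ?_⟩
  · intro i hi j hj hij
    have hi' : i < s.length := hlen ▸ hi
    have hj' : j < s.length := hlen ▸ hj
    simp only [List.getD_eq_getElem _ _ hi', List.getD_eq_getElem _ _ hj'] at hij
    have := hf.1 (hlt _ (List.getElem_mem hi')) (hlt _ (List.getElem_mem hj')) hij
    exact (hs.getElem_inj_iff).1 this
  · rcases adjacent_iff.1 (h p hp) with h | h
    exacts [hf.2 _ h, (hf.2 _ h).symm]

end Structure

section Extremal

lemma renumberings_spec : ∀ s ∈ renumberings, s.Nodup ∧ s.length = 8 ∧ ∀ x ∈ s, x < 8 := by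
  decide +kernel

/-- The distance function of `S_8^{3,3}(2, 1, 0)`. -/
def extremalDist : ℕ → ℕ → ℕ := pendentDist (cyclesDist 3 3) [(3, 7), (1, 6), (1, 5)]

lemma isDist_extremal : IsDist extremalEdges extremalDist :=
  isDist_spec (by decide +kernel)

lemma totalDegree_extremal : totalDegree extremalEdges = 18 := by
  decide +kernel

/-- The claimed maximum. -/
noncomputable def maxValue : ℝ := √2 + √(2 / 3) + √(3 / 4) + √(4 / 5) + √(5 / 12) + 3 * √(6 / 7)

lemma lt_maxValue : 7.41 < maxValue := by
  have h1 : (1.4142 : ℝ) < √2 := Real.lt_sqrt_of_sq_lt (by norm_num)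
  have h2 : (0.816 : ℝ) < √(2 / 3) := Real.lt_sqrt_of_sq_lt (by norm_num)
  have h3 : (0.866 : ℝ) < √(3 / 4) := Real.lt_sqrt_of_sq_lt (by norm_num)
  have h4 : (0.894 : ℝ) < √(4 / 5) := Real.lt_sqrt_of_sq_lt (by norm_num)
  have h5 : (0.645 : ℝ) < √(5 / 12) := Real.lt_sqrt_of_sq_lt (by norm_num)
  have h6 : (0.9258 : ℝ) < √(6 / 7) := Real.lt_sqrt_of_sq_lt (by norm_num)
  unfold maxValue
  linarith

lemma ABCGG_extremal : ABCGG (listGraph extremalEdges) = maxValue := by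
  rw [isDist_extremal.ABCGG_eq, maxValue]
  have hsqrt : √(2 : ℝ) = 2 * √(1 / 2) := by
    rw [show (2 : ℝ) = 2 ^ 2 * (1 / 2) by norm_num, Real.sqrt_mul (by norm_num),
      Real.sqrt_sq (by norm_num)]
    norm_num
  rw [hsqrt]
  have hcount :
      closerCount extremalDist 0 1 = 4 ∧ closerCount extremalDist 1 0 = 3 ∧
      closerCount extremalDist 0 2 = 4 ∧ closerCount extremalDist 2 0 = 1 ∧
      closerCount extremalDist 1 2 = 3 ∧ closerCount extremalDist 2 1 = 1 ∧
      closerCount extremalDist 0 3 = 5 ∧ closerCount extremalDist 3 0 = 2 ∧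
      closerCount extremalDist 0 4 = 5 ∧ closerCount extremalDist 4 0 = 1 ∧
      closerCount extremalDist 3 4 = 2 ∧ closerCount extremalDist 4 3 = 1 ∧
      closerCount extremalDist 1 5 = 7 ∧ closerCount extremalDist 5 1 = 1 ∧
      closerCount extremalDist 1 6 = 7 ∧ closerCount extremalDist 6 1 = 1 ∧
      closerCount extremalDist 3 7 = 7 ∧ closerCount extremalDist 7 3 = 1 := by
    decide +kernel
  obtain ⟨c01, c10, c02, c20, c12, c21, c03, c30, c04,
    c40, c34, c43, c15, c51, c16, c61, c37, c73⟩ := hcount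
  simp +decide only [Fin.sum_univ_eight, if_true, if_false, Fin.isValue, Fin.coe_ofNat_eq_mod,
    Nat.reduceMod, c01, c10, c02, c20, c12, c21, c03, c30, c04,
    c40, c34, c43, c15, c51, c16, c61, c37, c73]
  norm_num
  ring

/-- The identification of the vertices of `S_8^{3,3}(2, 1, 0)` with `Fin 8`. -/
def vertexIndex : SVert 2 0 1 0 0 → Fin 8
  | .inl i => i.castLE (by omega)
  | .inr (.inl i) => i.natAdd 5 |>.castLE (by omega)
  | _ => 7

lemma nonempty_iso_S33 : Nonempty (S33 2 0 1 0 0 ≃g listGraph extremalEdges) := by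
  have hbij : Function.Bijective vertexIndex := by decide +kernel
  have hadj : ∀ x y : SVert 2 0 1 0 0,
      adjacent extremalEdges (vertexIndex x) (vertexIndex y) = true ↔
        (S33 2 0 1 0 0).Adj x y := by
    simp only [S33, fromRel_adj]
    rintro (x | x | x | x | x | x) (y | y | y | y | y | y) <;>
      first
      | exact x.elim0
      | exact y.elim0
      | simp only [reduceCtorEq, Sum.inl.injEq, Sum.inr.injEq, false_and, and_false, or_false,
          false_or, exists_false, exists_and_left, exists_eq', and_true, ne_eq,
          not_false_eq_true, true_and]
        revert x y
        decide +kernel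
  exact ⟨⟨Equiv.ofBijective _ hbij, (isDist_extremal.adj_iff _ _).trans (hadj _ _)⟩⟩

end Extremal

lemma lt_maxValue_or_iso {V : Type*} [Fintype V] {G : SimpleGraph V} {r t : ℕ}
    (hr : 3 ≤ r) (hrt : r ≤ t) (hG : InSnrt G 8 r t) :
    ABCGG G < maxValue ∨ Nonempty (G ≃g S33 2 0 1 0 0) := by
  obtain ⟨f, hf⟩ := InSnrt.exists_isLabelling_cycles hG
  obtain ⟨hV, hconn, hE, -⟩ := hG
  have hle := hf.le_card
  rw [hV] at hle
  obtain ⟨Q, hQ, f', hf'⟩ := IsLabelling.exists_mem_extensions hconn hV (9 - r - t) (r + t - 1) []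
    f hf (cyclesEdges_lt (by omega) (by omega)) (by omega) (by omega)
  have hadm := List.all_eq_true.1 (familyAdmissible_of_le hr hrt (by omega)) Q hQ
  simp only [admissible, Bool.and_eq_true, Bool.or_eq_true, Nat.beq_eq, Nat.blt_eq,
    List.any_eq_true, List.all_eq_true] at hadm
  obtain ⟨⟨hd, hdeg⟩, hbound | ⟨s, hs, hadj⟩⟩ := hadm
  · left
    have hd := isDist_spec hd
    obtain ⟨e⟩ := hd.nonempty_iso hdeg hV hE hf'
    rw [← ABCGG_iso e]
    have hcast : (totalBound (Q ++ cyclesEdges r t) (pendentDist (cyclesDist r t) Q) : ℝ) <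
        14820 := by exact_mod_cast hbound
    have := hd.ABCGG_le
    have := lt_maxValue
    norm_num at this
    linarith
  · right
    obtain ⟨hs₁, hs₂, hs₃⟩ := renumberings_spec s hs
    obtain ⟨e⟩ := isDist_extremal.nonempty_iso totalDegree_extremal hV hE
      (hf'.renumber hs₁ hs₂ hs₃ hadj)
    obtain ⟨e'⟩ := nonempty_iso_S33
    exact ⟨e.symm.trans e'.symm⟩

end GraovacGhorbani

theorem stmt12 {V : Type*} [Fintype V] (G : SimpleGraph V) (r t : ℕ)
    (hr : 3 ≤ r) (ht : 3 ≤ t) (hG : InSnrt G 8 r t) :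
    ABCGG G ≤ Real.sqrt 2 + Real.sqrt (2 / 3) + Real.sqrt (3 / 4) + Real.sqrt (4 / 5) +
      Real.sqrt (5 / 12) + 3 * Real.sqrt (6 / 7) ∧
    (ABCGG G = Real.sqrt 2 + Real.sqrt (2 / 3) + Real.sqrt (3 / 4) + Real.sqrt (4 / 5) +
        Real.sqrt (5 / 12) + 3 * Real.sqrt (6 / 7) ↔
      Nonempty (G ≃g S33 2 0 1 0 0)) := by
  have key : ABCGG G < GraovacGhorbani.maxValue ∨ Nonempty (G ≃g S33 2 0 1 0 0) := by
    rcases le_total r t with h | h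
    · exact GraovacGhorbani.lt_maxValue_or_iso hr h hG
    · exact GraovacGhorbani.lt_maxValue_or_iso ht h (GraovacGhorbani.InSnrt.symm hG)
  have hiso : Nonempty (G ≃g S33 2 0 1 0 0) → ABCGG G = GraovacGhorbani.maxValue := by
    rintro ⟨e⟩
    obtain ⟨e'⟩ := GraovacGhorbani.nonempty_iso_S33
    rw [GraovacGhorbani.ABCGG_iso (e.trans e'), GraovacGhorbani.ABCGG_extremal]
  change ABCGG G ≤ GraovacGhorbani.maxValue ∧ (ABCGG G = GraovacGhorbani.maxValue ↔ _)
  refine ⟨?_, fun h => ?_, hiso⟩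
  · rcases key with h | h
    exacts [h.le, (hiso h).le]
  · rcases key with h' | h'
    exacts [absurd h h'.ne, h']
end
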